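/- arXiv:0901.3894 — 3 statements merged into one kernel-verified Lean document; each statement's English description precedes it below -/
import Mathlib

section
/- Every cyclically 4-edge-connected cubic graph with at least four vertices that is different from K_4 is matching double-covered. -/
open scoped Classical

noncomputable section

/-- A finite multigraph: finitely many vertices and edges, each edge has an
unordered pair of endpoints (parallel edges and loops are allowed). -/
structure Multigraph where
  V : Type
  E : Type
  fintypeV : Fintype V := by infer_instance
  fintypeE : Fintype E := by infer_instance
  ends : E → Sym2 V

namespace Multigraph

instance (G : Multigraph) : Fintype G.V := G.fintypeV
instance (G : Multigraph) : Fintype G.E := G.fintypeE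

/-- The number of endpoints of the edge `e` that are equal to `v`
(a loop at `v` counts twice). -/
def inc (G : Multigraph) (v : G.V) (e : G.E) : ℕ :=
  if G.ends e = Sym2.diag v then 2 else if v ∈ G.ends e then 1 else 0

/-- The degree of a vertex: the number of edge-ends at it (loops count twice). -/
def degree (G : Multigraph) (v : G.V) : ℕ := ∑ e : G.E, G.inc v e

/-- A graph is cubic if every vertex has degree three. -/
def IsCubic (G : Multigraph) : Prop := ∀ v : G.V, G.degree v = 3

/-- A perfect matching: a set of (non-loop) edges such that every vertex is
incident with exactly one edge of the set. -/
def IsPerfectMatching (G : Multigraph) (M : Finset G.E) : Prop :=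
  (∀ e ∈ M, ¬ (G.ends e).IsDiag) ∧
  ∀ v : G.V, ∃! e, e ∈ M ∧ v ∈ G.ends e

/-- The number of perfect matchings of `G`. -/
def pmCount (G : Multigraph) : ℕ :=
  Nat.card {M : Finset G.E // G.IsPerfectMatching M}

/-- Every edge lies in some perfect matching. -/
def MatchingCovered (G : Multigraph) : Prop :=
  ∀ e : G.E, ∃ M, G.IsPerfectMatching M ∧ e ∈ M

/-- Every edge lies in at least two perfect matchings. -/
def MatchingDoubleCovered (G : Multigraph) : Prop :=
  ∀ e : G.E, 2 ≤ Nat.card {M : Finset G.E // G.IsPerfectMatching M ∧ e ∈ M}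

/-- Adjacency via some edge. -/
def Adj (G : Multigraph) (u v : G.V) : Prop := ∃ e : G.E, G.ends e = s(u, v)

/-- The graph is connected. -/
def Connected (G : Multigraph) : Prop :=
  Nonempty G.V ∧ ∀ u v : G.V, Relation.ReflTransGen G.Adj u v

/-- The edge-cut `E(A, Aᶜ)`: edges with one end in `A` and the other outside. -/
def cutEdges (G : Multigraph) (A : Set G.V) : Set G.E :=
  {e | ∃ u v, G.ends e = s(u, v) ∧ u ∈ A ∧ v ∉ A}

/-- `G` is `k`-edge-connected: no edge-cut has fewer than `k` edges. -/
def EdgeConnected (G : Multigraph) (k : ℕ) : Prop :=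
  ∀ A : Set G.V, A.Nonempty → A ≠ Set.univ → k ≤ (G.cutEdges A).ncard

/-- Bridgeless = 2-edge-connected: connected with no edge-cut of size `< 2`. -/
def Bridgeless (G : Multigraph) : Prop := G.Connected ∧ G.EdgeConnected 2

/-- The subgraph induced on `A` contains a cycle (two parallel edges count as a
cycle of length two): there is a nonempty set of edges inside `A` in which every
vertex is incident with zero or at least two edge-ends. -/
def HasCycleWithin (G : Multigraph) (A : Set G.V) : Prop :=
  ∃ F : Finset G.E, F.Nonempty ∧ (∀ e ∈ F, ∀ v ∈ G.ends e, v ∈ A) ∧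
    ∀ v : G.V, (∑ e ∈ F, G.inc v e) ≠ 1

/-- The edge-cut `E(A, Aᶜ)` is cyclic: both sides contain a cycle. -/
def IsCyclicCut (G : Multigraph) (A : Set G.V) : Prop :=
  G.HasCycleWithin A ∧ G.HasCycleWithin Aᶜ

/-- `G` is cyclically `k`-edge-connected: no cyclic edge-cut has fewer than `k` edges. -/
def CyclicallyEdgeConnected (G : Multigraph) (k : ℕ) : Prop :=
  ∀ A : Set G.V, G.IsCyclicCut A → k ≤ (G.cutEdges A).ncard

/-- A cut is tight: every perfect matching contains exactly one of its edges. -/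
def IsTightCut (G : Multigraph) (A : Set G.V) : Prop :=
  ∀ M : Finset G.E, G.IsPerfectMatching M →
    (M.filter (fun e => e ∈ G.cutEdges A)).card = 1

/-- Adjacency within a set `A` of vertices. -/
def AdjOn (G : Multigraph) (A : Set G.V) (u v : G.V) : Prop :=
  u ∈ A ∧ v ∈ A ∧ G.Adj u v

/-- The subgraph induced on `A` is connected (any two of its vertices are joined
by a walk inside `A`). -/
def ConnectedOn (G : Multigraph) (A : Set G.V) : Prop :=
  ∀ u ∈ A, ∀ v ∈ A, Relation.ReflTransGen (G.AdjOn A) u v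

/-- `G` is `k`-vertex-connected: it has at least `k+1` vertices and removing any
set of at most `k-1` vertices leaves it connected. -/
def VertexConnected (G : Multigraph) (k : ℕ) : Prop :=
  k + 1 ≤ Fintype.card G.V ∧
  ∀ T : Set G.V, T.ncard ≤ k - 1 → G.ConnectedOn Tᶜ

/-- `{x, y}` is a 2-vertex-cut: removing both vertices disconnects the graph. -/
def IsVertexCutPair (G : Multigraph) (x y : G.V) : Prop :=
  x ≠ y ∧ ¬ G.ConnectedOn ({x, y}ᶜ)

/-- `G` is bipartite: the vertices split into two classes so that each edge
joins the two classes. -/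
def Bipartite (G : Multigraph) : Prop :=
  ∃ X : Set G.V, ∀ e : G.E, ∃ u v, G.ends e = s(u, v) ∧ u ∈ X ∧ v ∉ X

/-- Delete a set of edges (keeping all vertices). -/
def deleteEdges (G : Multigraph) (F : Set G.E) : Multigraph where
  V := G.V
  E := {e : G.E // e ∉ F}
  ends e := G.ends e.1

/-- Contract the vertex set `A` to a single vertex (`none`), deleting the arising
loops and keeping parallel edges. -/
def contract (G : Multigraph) (A : Set G.V) : Multigraph where
  V := Option {x : G.V // x ∉ A}
  E := {e : G.E // ¬ ∀ v ∈ G.ends e, v ∈ A}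
  ends e := (G.ends e.1).map fun x => if h : x ∈ A then none else some ⟨x, h⟩

/-- Isomorphism of multigraphs. -/
def Iso (G₁ G₂ : Multigraph) : Prop :=
  ∃ (f : G₁.V ≃ G₂.V) (g : G₁.E ≃ G₂.E), ∀ e, G₂.ends (g e) = (G₁.ends e).map f

/-- The complete graph on four vertices. -/
def K4 : Multigraph where
  V := Fin 4
  E := {p : Fin 4 × Fin 4 // p.1 < p.2}
  ends p := s(p.1.1, p.1.2)

/-- The result of simultaneously replacing every vertex of `S` by a triangle;
`σ e v` records to which of the three triangle vertices at `v` the edge `e`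
(formerly ending at `v`) is attached. -/
def expandTriangles (H : Multigraph) (S : Set H.V) (σ : H.E → H.V → Fin 3) :
    Multigraph where
  V := {x : H.V // x ∉ S} ⊕ (S × Fin 3)
  E := H.E ⊕ (S × Fin 3)
  ends e :=
    match e with
    | Sum.inl e => (H.ends e).map fun x =>
        if h : x ∈ S then Sum.inr (⟨x, h⟩, σ e x) else Sum.inl ⟨x, h⟩
    | Sum.inr (w, i) => s(Sum.inr (w, i + 1), Sum.inr (w, i + 2))

/-- `G` is obtained from `H` by replacing each vertex of `S` with a triangle:
the three edges formerly incident with a vertex of `S` get attached to the three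
distinct new triangle vertices. -/
def IsTriangleExpansion (H : Multigraph) (S : Set H.V) (G : Multigraph) : Prop :=
  ∃ σ : H.E → H.V → Fin 3,
    (∀ v ∈ S, ∀ e : H.E, H.ends e ≠ Sym2.diag v) ∧
    (∀ v ∈ S, Set.InjOn (fun e => σ e v) {e : H.E | v ∈ H.ends e}) ∧
    Iso (expandTriangles H S σ) G

/-- Klee-graphs: `K₄` together with everything obtainable by repeatedly replacing
a vertex with a triangle. -/
inductive IsKlee : Multigraph → Prop
  | k4 (G : Multigraph) : Iso K4 G → IsKlee G
  | expand (G : Multigraph) (v : G.V) (H : Multigraph) :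
      IsKlee G → IsTriangleExpansion G {v} H → IsKlee H

/-- A nice 3-edge-cut (of a cubic graph). -/
def IsNiceCut (G : Multigraph) (A : Set G.V) : Prop :=
  A.Nonempty ∧ A ≠ Set.univ ∧ (G.cutEdges A).ncard = 3 ∧
  ¬ IsKlee (G.contract A) ∧
  (¬ IsKlee (G.contract Aᶜ) ∨
   9 ≤ A.ncard ∨
   (5 ≤ A.ncard ∧ ¬ G.IsTightCut A) ∨
   (A.ncard = 3 ∧
     2 ≤ Nat.card {M : Finset G.E // G.IsPerfectMatching M ∧
       ∀ e ∈ G.cutEdges A, e ∈ M}))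

/-- A brace: a bipartite matching covered graph without nontrivial tight edge-cuts. -/
def IsBrace (H : Multigraph) : Prop :=
  H.Bipartite ∧ H.MatchingCovered ∧
  ∀ A : Set H.V, 2 ≤ A.ncard → 2 ≤ Aᶜ.ncard → ¬ H.IsTightCut A

/-- Data describing a simultaneous gluing of graphs `K w` (through their vertices
`z w`) onto the vertices `w ∈ W` of `H`: the edge `e` of `H` incident with `w`
is identified with the edge `ε w e` of `K w` incident with `z w`, whose other
end is `y w e`. -/
structure GlueData (H : Multigraph) (W : Set H.V) where
  K : W → Multigraph
  z : (w : W) → (K w).V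
  d : (w : W) → {x : (K w).V // x ≠ z w}
  ε : (w : W) → H.E → (K w).E
  y : (w : W) → H.E → {x : (K w).V // x ≠ z w}
  noloop : ∀ (w : W) (e : H.E), H.ends e ≠ Sym2.diag (w : H.V)
  noloopK : ∀ (w : W) (k : (K w).E), (K w).ends k ≠ Sym2.diag (z w)
  ends_eq : ∀ (w : W) (e : H.E), (w : H.V) ∈ H.ends e →
      (K w).ends (ε w e) = s(z w, (y w e : (K w).V))
  inj : ∀ w : W, Set.InjOn (ε w) {e : H.E | (w : H.V) ∈ H.ends e}
  surj : ∀ (w : W) (k : (K w).E), z w ∈ (K w).ends k →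
      ∃ e : H.E, (w : H.V) ∈ H.ends e ∧ ε w e = k

/-- The graph obtained by gluing each `D.K w` through `D.z w` onto the vertex
`w ∈ W` of `H`. -/
def glue (H : Multigraph) (W : Set H.V) (D : GlueData H W) : Multigraph where
  V := {x : H.V // x ∉ W} ⊕ (Σ w : W, {x : (D.K w).V // x ≠ D.z w})
  E := H.E ⊕ (Σ w : W, {k : (D.K w).E // D.z w ∉ (D.K w).ends k})
  ends e :=
    match e with
    | Sum.inl e => (H.ends e).map fun x =>
        if h : x ∈ W then Sum.inr ⟨⟨x, h⟩, D.y ⟨x, h⟩ e⟩ else Sum.inl ⟨x, h⟩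
    | Sum.inr ⟨w, k⟩ => ((D.K w).ends k.1).map fun x =>
        if h : x = D.z w then Sum.inr ⟨w, D.d w⟩ else Sum.inr ⟨w, ⟨x, h⟩⟩

/-- The multiset of vertex degrees different from three. -/
def nonCubicDegrees (G : Multigraph) : Multiset ℕ :=
  ((Finset.univ : Finset G.V).val.map G.degree).filter (· ≠ 3)

/-- `H` is an odd minor of `G`: it is obtained by contracting pairwise disjoint
connected subgraphs, each with an odd number of vertices (deleting arising loops
and keeping parallel edges). -/
def IsOddMinor (G H : Multigraph) : Prop :=
  ∃ π : G.V → H.V, Function.Surjective π ∧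
    (∀ w : H.V, G.ConnectedOn (π ⁻¹' {w}) ∧ Odd (π ⁻¹' {w}).ncard) ∧
    ∃ g : {e : G.E // ∃ u v, G.ends e = s(u, v) ∧ π u ≠ π v} ≃ H.E,
      ∀ e, H.ends (g e) = (G.ends e.1).map π

/-- The 6-vertex graph consisting of two nonadjacent vertices `x = 0`, `y = 1`
and four vertices `a = 2`, `b = 3`, `c = 4`, `d = 5`, with edges `ab`, `cd` and
an edge from each of `a`, `b`, `c`, `d` to each of `x` and `y`. -/
def specialGraph : Multigraph where
  V := Fin 6
  E := Fin 10
  ends := ![s(2, 3), s(4, 5), s(2, 0), s(2, 1), s(3, 0), s(3, 1),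
            s(4, 0), s(4, 1), s(5, 0), s(5, 1)]

/-- The perfect matching polytope: the convex hull of the characteristic vectors
of the perfect matchings. -/
def pmPolytope (G : Multigraph) : Set (G.E → ℝ) :=
  convexHull ℝ {w | ∃ M : Finset G.E, G.IsPerfectMatching M ∧
    w = fun e => if e ∈ M then (1 : ℝ) else 0}

end Multigraph

open Multigraph

/-- If a graph of even order has no perfect matching, Tutte's theorem and parity yield a vertex set
`S` and a family of at least `|S| + 2` odd components of the graph with `S` removed. -/
theorem SimpleGraph.exists_odd_family_of_no_perfectMatching {V : Type*} [Fintype V]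
    (H : SimpleGraph V) (heven : Even (Fintype.card V))
    (hH : ¬ ∃ M : H.Subgraph, M.IsPerfectMatching) :
    ∃ (S : Finset V) (P : Finset (Finset V)), S.card + 2 ≤ P.card ∧
      (∀ A ∈ P, Odd A.card) ∧ (∀ A ∈ P, ∀ x ∈ A, x ∉ S) ∧
      (∀ A ∈ P, ∀ B ∈ P, ∀ x ∈ A, x ∈ B → A = B) ∧
      ∀ A ∈ P, ∀ x ∈ A, ∀ y, H.Adj x y → y ∉ S → y ∈ A := by
  rw [SimpleGraph.tutte] at hH
  push Not at hH
  obtain ⟨u, hu⟩ := hH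
  unfold SimpleGraph.IsTutteViolator at hu
  have hverts : ((⊤ : H.Subgraph).deleteVerts u).verts = uᶜ := by
    simp [Set.compl_eq_univ_sdiff]
  set K := ((⊤ : H.Subgraph).deleteVerts u).coe with hK
  have hpar := SimpleGraph.odd_ncard_oddComponents K
  have hcardK : Nat.card ((⊤ : H.Subgraph).deleteVerts u).verts + u.ncard = Fintype.card V := by
    rw [hverts, ← Nat.card_eq_fintype_card, Nat.card_coe_set_eq, add_comm]
    exact Set.ncard_add_ncard_compl u
  let F : K.ConnectedComponent → Finset V := fun c => (Subtype.val '' c.supp).toFinset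
  have hF : ∀ c x, x ∈ F c ↔ ∃ h : x ∈ ((⊤ : H.Subgraph).deleteVerts u).verts,
      K.connectedComponentMk ⟨x, h⟩ = c := by
    intro c x
    simp only [F, Set.mem_toFinset, Set.mem_image, SimpleGraph.ConnectedComponent.mem_supp_iff]
    constructor
    · rintro ⟨⟨y, hy⟩, h, rfl⟩
      exact ⟨hy, h⟩
    · rintro ⟨h, h'⟩
      exact ⟨⟨x, h⟩, h', rfl⟩
  have hFinj : Function.Injective F := by
    intro c d h
    obtain ⟨⟨x, hx⟩, rfl⟩ := c.exists_rep
    have : x ∈ F d := h ▸ (hF _ x).2 ⟨hx, rfl⟩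
    exact ((hF _ x).1 this).2
  refine ⟨u.toFinset, K.oddComponents.toFinset.image F, ?_, ?_, ?_, ?_, ?_⟩
  · rw [Finset.card_image_of_injective _ hFinj, ← Set.ncard_eq_toFinset_card',
      ← Set.ncard_eq_toFinset_card']
    grind
  · simp only [Finset.mem_image, Set.mem_toFinset]
    rintro A ⟨c, hc, rfl⟩
    have : Odd c.supp.ncard := hc
    rw [← Set.ncard_image_of_injective _ Subtype.val_injective] at this
    rwa [Set.ncard_eq_toFinset_card'] at this
  · simp only [Finset.mem_image, Set.mem_toFinset]
    rintro A ⟨c, hc, rfl⟩ x hx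
    obtain ⟨h, -⟩ := (hF _ x).1 hx
    rw [hverts] at h
    exact h
  · simp only [Finset.mem_image, Set.mem_toFinset]
    rintro A ⟨c, hc, rfl⟩ B ⟨d, hd, rfl⟩ x hx hx'
    obtain ⟨h, rfl⟩ := (hF _ x).1 hx
    obtain ⟨h', rfl⟩ := (hF _ x).1 hx'
    rfl
  · simp only [Finset.mem_image, Set.mem_toFinset]
    rintro A ⟨c, hc, rfl⟩ x hx y hxy hy
    obtain ⟨h, rfl⟩ := (hF _ x).1 hx
    have h' : y ∈ ((⊤ : H.Subgraph).deleteVerts u).verts := by rw [hverts]; exact hy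
    refine (hF _ y).2 ⟨h', ?_⟩
    rw [SimpleGraph.ConnectedComponent.eq]
    refine SimpleGraph.Adj.reachable ?_
    rw [hverts] at h h'
    simpa [hK, hxy.symm] using ⟨h', h⟩

namespace Multigraph

variable {G : Multigraph}

theorem inc_of_ends {e : G.E} {x y : G.V} (h : G.ends e = s(x, y)) (v : G.V) :
    G.inc v e = (if v = x then 1 else 0) + (if v = y then 1 else 0) := by
  have hd : Sym2.diag v = s(v, v) := rfl
  simp only [inc, h, hd, Sym2.eq_iff, Sym2.mem_iff]
  grind

/-- The number of ends of the edge `e` in the vertex set `A`. -/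
def incOn (G : Multigraph) (A : Finset G.V) (e : G.E) : ℕ := ∑ v ∈ A, G.inc v e

theorem incOn_of_ends {e : G.E} {x y : G.V} (h : G.ends e = s(x, y)) (A : Finset G.V) :
    G.incOn A e = (if x ∈ A then 1 else 0) + (if y ∈ A then 1 else 0) := by
  simp only [incOn, inc_of_ends h, Finset.sum_add_distrib, Finset.sum_ite_eq']

/-- The finset of edges with exactly one end in `A`. -/
def cut (G : Multigraph) (A : Finset G.V) : Finset G.E :=
  Finset.univ.filter fun e => G.incOn A e = 1

/-- The finset of edges with both ends in `A`. -/
def inside (G : Multigraph) (A : Finset G.V) : Finset G.E :=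
  Finset.univ.filter fun e => G.incOn A e = 2

theorem mem_cut {e : G.E} {x y : G.V} (h : G.ends e = s(x, y)) (A : Finset G.V) :
    e ∈ G.cut A ↔ ¬ (x ∈ A ↔ y ∈ A) := by
  simp only [cut, Finset.mem_filter, Finset.mem_univ, true_and, incOn_of_ends h]
  grind

theorem mem_inside {e : G.E} {x y : G.V} (h : G.ends e = s(x, y)) (A : Finset G.V) :
    e ∈ G.inside A ↔ x ∈ A ∧ y ∈ A := by
  simp only [inside, Finset.mem_filter, Finset.mem_univ, true_and, incOn_of_ends h]
  grind

theorem exists_ends (e : G.E) : ∃ x y, G.ends e = s(x, y) := by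
  induction h : G.ends e with | _ x y => exact ⟨x, y, rfl⟩

theorem coe_cut (A : Finset G.V) : (G.cut A : Set G.E) = G.cutEdges A := by
  ext e
  obtain ⟨x, y, h⟩ := exists_ends e
  simp only [Finset.mem_coe, mem_cut h, cutEdges, Set.mem_ofPred_eq, h, Sym2.eq_iff]
  grind

theorem cut_compl (A : Finset G.V) : G.cut Aᶜ = G.cut A := by
  ext e
  obtain ⟨x, y, h⟩ := exists_ends e
  simp only [mem_cut h, Finset.mem_compl]
  grind

theorem mem_cut_symmDiff (S T : Finset G.V) (e : G.E) :
    e ∈ G.cut (symmDiff S T) ↔ ¬ (e ∈ G.cut S ↔ e ∈ G.cut T) := by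
  obtain ⟨x, y, h⟩ := exists_ends e
  simp only [mem_cut h, Finset.mem_symmDiff]
  by_cases x ∈ S <;> by_cases y ∈ S <;> by_cases x ∈ T <;> by_cases y ∈ T <;> simp [*]

theorem sum_incOn (hcubic : G.IsCubic) (A : Finset G.V) : ∑ e, G.incOn A e = 3 * A.card := by
  calc ∑ e, G.incOn A e = ∑ v ∈ A, G.degree v := Finset.sum_comm
    _ = 3 * A.card := by simp [hcubic _, mul_comm]

theorem two_mul_card_inside_add_card_cut (hcubic : G.IsCubic) (A : Finset G.V) :
    2 * (G.inside A).card + (G.cut A).card = 3 * A.card := by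
  rw [← sum_incOn hcubic, inside, cut, Finset.card_filter, Finset.card_filter, Finset.mul_sum,
    ← Finset.sum_add_distrib]
  refine Finset.sum_congr rfl fun e _ => ?_
  obtain ⟨x, y, h⟩ := exists_ends e
  simp only [incOn_of_ends h]
  grind

/-- At least `|A|` edges spanned by a nonempty vertex set `A` contain a cycle. -/
theorem exists_cycle_of_card_le (n : ℕ) : ∀ (A : Finset G.V) (F : Finset G.E), A.card = n →
    A.Nonempty → (∀ e ∈ F, ∀ v ∈ G.ends e, v ∈ A) → A.card ≤ F.card →
    G.HasCycleWithin A := by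
  induction n with
  | zero => intro A F h hA; exact absurd h hA.card_pos.ne'
  | succ n ih =>
    intro A F hn hA hF hle
    by_cases hdeg : ∀ v : G.V, (∑ e ∈ F, G.inc v e) ≠ 1
    · exact ⟨F, Finset.card_pos.1 (hA.card_pos.trans_le hle), hF, hdeg⟩
    push Not at hdeg
    obtain ⟨v, hv⟩ := hdeg
    obtain ⟨e, heF, he⟩ : ∃ e ∈ F, G.inc v e ≠ 0 := by
      by_contra! h
      rw [Finset.sum_eq_zero h] at hv
      exact zero_ne_one hv
    have hsum := Finset.add_sum_erase F (G.inc v) heF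
    have he1 : G.inc v e = 1 := by omega
    have hrest : ∑ e ∈ F.erase e, G.inc v e = 0 := by omega
    rw [Finset.sum_eq_zero_iff] at hrest
    obtain ⟨x, y, hxy⟩ := exists_ends e
    have hx : x ∈ A := hF e heF x (by simp [hxy])
    have hy : y ∈ A := hF e heF y (by simp [hxy])
    rw [inc_of_ends hxy] at he1
    have hvA : v ∈ A := by grind
    obtain ⟨F', h1, h2, h3⟩ := ih (A.erase v) (F.erase e) (by rw [Finset.card_erase_of_mem hvA]; omega)
      (by
        by_cases hxv : x = v
        · exact ⟨y, by grind⟩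
        · exact ⟨x, by grind⟩)
      (by
        intro e' he' w hw
        refine Finset.mem_erase.2 ⟨?_, hF e' (Finset.mem_of_mem_erase he') w hw⟩
        rintro rfl
        have h0 := hrest e' he'
        obtain ⟨a, b, hab⟩ := exists_ends e'
        rw [inc_of_ends hab] at h0
        rw [hab, Sym2.mem_iff] at hw
        grind)
      (by rw [Finset.card_erase_of_mem hvA, Finset.card_erase_of_mem heF]; omega)
    exact ⟨F', h1, fun e' he' w hw => Finset.mem_of_mem_erase (h2 e' he' w hw), h3⟩

theorem hasCycleWithin_of_card_le {A : Finset G.V} (hA : A.Nonempty)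
    (h : A.card ≤ (G.inside A).card) : G.HasCycleWithin A := by
  refine exists_cycle_of_card_le _ A (G.inside A) rfl hA ?_ h
  intro e he v hv
  obtain ⟨x, y, hxy⟩ := exists_ends e
  rw [mem_inside hxy] at he
  rw [hxy, Sym2.mem_iff] at hv
  grind

/-- In a cyclically 4-edge-connected cubic graph, a nontrivial cut with at most three edges has
exactly three edges and separates a single vertex. -/
theorem cut_eq_three (hcubic : G.IsCubic) (h4 : G.CyclicallyEdgeConnected 4)
    {A : Finset G.V} (hA : A.Nonempty) (hAc : Aᶜ.Nonempty) (hcut : (G.cut A).card ≤ 3) :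
    (G.cut A).card = 3 ∧ (A.card = 1 ∨ Aᶜ.card = 1) := by
  have key : ∀ B : Finset G.V, B.Nonempty → (G.cut B).card ≤ 3 → ¬ G.HasCycleWithin B →
      (G.cut B).card = 3 ∧ B.card = 1 := by
    intro B hB hc hcyc
    have := two_mul_card_inside_add_card_cut hcubic B
    have h1 := mt (hasCycleWithin_of_card_le hB) hcyc
    have := hB.card_pos
    omega
  by_cases h1 : G.HasCycleWithin A
  · by_cases h2 : G.HasCycleWithin (Aᶜ : Finset G.V)
    · have := h4 A ⟨h1, by rwa [Finset.coe_compl] at h2⟩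
      rw [← coe_cut, Set.ncard_coe_finset] at this
      omega
    · have := key _ hAc (by rwa [cut_compl]) h2
      rw [cut_compl] at this
      exact ⟨this.1, Or.inr this.2⟩
  · exact ⟨(key _ hA hcut h1).1, Or.inl (key _ hA hcut h1).2⟩

theorem even_card (hcubic : G.IsCubic) : Even (Fintype.card G.V) := by
  have h := two_mul_card_inside_add_card_cut hcubic Finset.univ
  have h0 : G.cut Finset.univ = ∅ := by
    ext e
    obtain ⟨x, y, hxy⟩ := exists_ends e
    simp [mem_cut hxy]
  rw [h0, Finset.card_empty, Finset.card_univ] at h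
  exact ⟨(G.inside Finset.univ).card - Fintype.card G.V, by omega⟩

theorem ne_of_ends (hcubic : G.IsCubic) (h4 : G.CyclicallyEdgeConnected 4)
    (hcard : 4 ≤ Fintype.card G.V) {e : G.E} {x y : G.V} (h : G.ends e = s(x, y)) : x ≠ y := by
  rintro rfl
  have h1 := two_mul_card_inside_add_card_cut hcubic {x}
  have h2 : 0 < (G.inside {x}).card := Finset.card_pos.2 ⟨e, by simp [mem_inside h]⟩
  have h3 := cut_eq_three hcubic h4 (Finset.singleton_nonempty x)
    (Finset.card_pos.1 (by rw [Finset.card_compl, Finset.card_singleton]; omega))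
    (by rw [Finset.card_singleton] at h1; omega)
  rw [Finset.card_singleton] at h1
  omega

theorem eq_of_ends (hcubic : G.IsCubic) (h4 : G.CyclicallyEdgeConnected 4)
    (hcard : 4 ≤ Fintype.card G.V) {e f : G.E} {x y : G.V} (he : G.ends e = s(x, y))
    (hf : G.ends f = s(x, y)) : e = f := by
  by_contra hne
  have hxy := ne_of_ends hcubic h4 hcard he
  have h1 := two_mul_card_inside_add_card_cut hcubic {x, y}
  have h2 : 1 < (G.inside {x, y}).card :=
    Finset.one_lt_card.2 ⟨e, by simp [mem_inside he], f, by simp [mem_inside hf], hne⟩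
  rw [Finset.card_pair hxy] at h1
  have h3 := cut_eq_three hcubic h4 (Finset.insert_nonempty x {y})
    (Finset.card_pos.1 (by rw [Finset.card_compl, Finset.card_pair hxy]; omega)) (by omega)
  omega

/-- The finset of edges incident with the vertex `v`. -/
def star (G : Multigraph) (v : G.V) : Finset G.E := Finset.univ.filter fun e => v ∈ G.ends e

theorem mem_star {v : G.V} {e : G.E} : e ∈ G.star v ↔ v ∈ G.ends e := by simp [star]

theorem card_star (hcubic : G.IsCubic) (hloop : ∀ e x y, G.ends e = s(x, y) → x ≠ y) (v : G.V) :
    (G.star v).card = 3 := by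
  rw [← hcubic v, star, Finset.card_filter, degree]
  refine Finset.sum_congr rfl fun e _ => ?_
  obtain ⟨x, y, h⟩ := exists_ends e
  have := hloop e x y h
  simp only [inc_of_ends h, h, Sym2.mem_iff]
  grind

/-- The simple graph of adjacencies realised by edges outside `D`. -/
def simpleAvoiding (G : Multigraph) (D : Finset G.E) : SimpleGraph G.V where
  Adj x y := x ≠ y ∧ ∃ e, e ∉ D ∧ G.ends e = s(x, y)
  symm := ⟨fun x y ⟨h, e, he, h'⟩ => ⟨h.symm, e, he, by rw [h', Sym2.eq_swap]⟩⟩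
  loopless := ⟨fun _ h => h.1 rfl⟩

theorem exists_isPerfectMatching_of_simpleAvoiding
    (hpar : ∀ e f x y, G.ends e = s(x, y) → G.ends f = s(x, y) → e = f) (D : Finset G.E)
    (h : ∃ M : (G.simpleAvoiding D).Subgraph, M.IsPerfectMatching) :
    ∃ M, G.IsPerfectMatching M ∧ ∀ e ∈ M, e ∉ D := by
  obtain ⟨M, hM, hspan⟩ := h
  refine ⟨Finset.univ.filter fun e => e ∉ D ∧ ∃ x y, G.ends e = s(x, y) ∧ M.Adj x y,
    ⟨?_, fun v => ?_⟩, ?_⟩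
  · simp only [Finset.mem_filter, Finset.mem_univ, true_and]
    rintro e ⟨-, x, y, h, hxy⟩
    rw [h, Sym2.mk_isDiag_iff]
    exact hxy.ne
  · obtain ⟨w, hw, huniq⟩ := hM (hspan v)
    obtain ⟨-, e, he, hends⟩ := M.adj_sub hw
    refine ⟨e, ⟨by simpa [he] using ⟨v, w, hends, hw⟩, by simp [hends]⟩, ?_⟩
    simp only [Finset.mem_filter, Finset.mem_univ, true_and]
    rintro f ⟨⟨-, x, y, h, hxy⟩, hv⟩
    rw [h, Sym2.mem_iff] at hv
    rcases hv with rfl | rfl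
    · obtain rfl := huniq y hxy
      exact hpar _ _ _ _ h hends
    · obtain rfl := huniq x hxy.symm
      exact hpar _ _ _ _ h (by rw [hends, Sym2.eq_swap])
  · simp only [Finset.mem_filter, Finset.mem_univ, true_and]
    exact fun e he => he.1

/-- If deleting at most three edges `D` from a cyclically 4-edge-connected cubic graph without
isolating a vertex destroys all perfect matchings, then `|D| = 3` and the remaining edges form an
edge-cut. -/
theorem cut_eq_compl_of_no_perfectMatching (hcubic : G.IsCubic)
    (h4 : G.CyclicallyEdgeConnected 4) (hcard : 4 ≤ Fintype.card G.V) {D : Finset G.E}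
    (hD : D.card ≤ 3) (hiso : ∀ x, ∃ e ∉ D, x ∈ G.ends e)
    (hno : ¬ ∃ M, G.IsPerfectMatching M ∧ ∀ e ∈ M, e ∉ D) :
    D.card = 3 ∧ ∃ S, G.cut S = Dᶜ := by
  have heven := even_card hcubic
  obtain ⟨S, P, hcardP, hodd, hPS, hdisj, hclosed⟩ :=
    (G.simpleAvoiding D).exists_odd_family_of_no_perfectMatching heven
      fun h => hno (exists_isPerfectMatching_of_simpleAvoiding
        (fun e f x y => eq_of_ends hcubic h4 hcard) D h)
  have hadj : ∀ e ∉ D, ∀ x y, G.ends e = s(x, y) → (G.simpleAvoiding D).Adj x y :=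
    fun e he x y h => ⟨ne_of_ends hcubic h4 hcard h, e, he, h⟩
  have hne : ∀ A ∈ P, A.Nonempty := fun A hA => Finset.card_pos.1 (hodd A hA).pos
  have hnec : ∀ A ∈ P, Aᶜ.Nonempty := by
    intro A hA
    rw [Finset.nonempty_iff_ne_empty, Ne, Finset.compl_eq_empty_iff]
    rintro rfl
    have := hodd _ hA
    rw [Finset.card_univ] at this
    exact (Nat.not_even_iff_odd.2 this) heven
  have hthree : ∀ A ∈ P, 3 ≤ (G.cut A).card := by
    intro A hA
    by_contra! h
    have := (cut_eq_three hcubic h4 (hne A hA) (hnec A hA) h.le).1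
    omega
  have hSP : ∀ x ∈ S, ¬ ∃ A ∈ P, x ∈ A := fun x hx ⟨A, hA, hxA⟩ => hPS A hA x hxA hx
  set N : G.E → ℕ := fun e => (P.filter fun A => e ∈ G.cut A).card with hN
  have hNle : ∀ e x y, G.ends e = s(x, y) →
      N e ≤ (if ∃ A ∈ P, x ∈ A then 1 else 0) + (if ∃ A ∈ P, y ∈ A then 1 else 0) := by
    intro e x y h
    have hone : ∀ z, (P.filter fun A => z ∈ A).card ≤ (if ∃ A ∈ P, z ∈ A then 1 else 0) := by
      intro z
      split_ifs with hz
      · refine Finset.card_le_one.2 fun A hA B hB => ?_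
        rw [Finset.mem_filter] at hA hB
        exact hdisj A hA.1 B hB.1 z hA.2 hB.2
      · push Not at hz
        rw [Finset.filter_eq_empty_iff.2 fun A hA => hz A hA, Finset.card_empty]
    refine le_trans ?_ (add_le_add (hone x) (hone y))
    refine le_trans (Finset.card_le_card ?_) (Finset.card_union_le _ _)
    intro A hA
    simp only [Finset.mem_union, Finset.mem_filter, mem_cut h] at hA ⊢
    grind
  have hpoint : ∀ e, N e ≤ G.incOn S e + if e ∈ D then 2 else 0 := by
    intro e
    obtain ⟨x, y, h⟩ := exists_ends e
    split_ifs with he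
    · have := hNle e x y h
      split_ifs at this <;> omega
    · rw [incOn_of_ends h]
      by_cases hx : x ∈ S
      · have := hNle e x y h
        rw [if_neg (hSP x hx)] at this
        rw [if_pos hx]
        split_ifs at this ⊢ <;> omega
      · by_cases hy : y ∈ S
        · have := hNle e x y h
          rw [if_neg (hSP y hy)] at this
          rw [if_pos hy]
          split_ifs at this ⊢ <;> omega
        · simp only [hN, hx, hy, if_false, add_zero, Nat.le_zero, Finset.card_eq_zero,
            Finset.filter_eq_empty_iff, mem_cut h, not_not]
          exact fun A hA => ⟨fun h' => hclosed A hA x h' y (hadj e he x y h) hy,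
            fun h' => hclosed A hA y h' x (hadj e he x y h).symm hx⟩
  have hsumN : ∑ e, N e = ∑ A ∈ P, (G.cut A).card := by
    simp only [hN, Finset.card_filter, cut, Finset.mem_filter, Finset.mem_univ, true_and]
    exact Finset.sum_comm
  have hlow : 3 * P.card ≤ ∑ A ∈ P, (G.cut A).card := by
    rw [mul_comm, ← smul_eq_mul]
    exact Finset.card_nsmul_le_sum _ _ _ hthree
  have hupp : ∑ e, (G.incOn S e + if e ∈ D then 2 else 0) = 3 * S.card + 2 * D.card := by
    rw [Finset.sum_add_distrib, sum_incOn hcubic]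
    simp [mul_comm]
  have hle := Finset.sum_le_sum fun e (_ : e ∈ Finset.univ) => hpoint e
  have heq : ∀ e, N e = G.incOn S e + if e ∈ D then 2 else 0 := by
    have := (Finset.sum_eq_sum_iff_of_le fun e (_ : e ∈ Finset.univ) => hpoint e).1 (by omega)
    exact fun e => this e (Finset.mem_univ e)
  have hcut3 : ∀ A ∈ P, (G.cut A).card = 3 := by
    have h3 : ∑ A ∈ P, 3 = ∑ A ∈ P, (G.cut A).card := by
      rw [Finset.sum_const, smul_eq_mul]
      omega
    exact fun A hA => ((Finset.sum_eq_sum_iff_of_le hthree).1 h3 A hA).symm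
  have hDcover : ∀ e ∈ D, ∀ x y, G.ends e = s(x, y) →
      (∃ A ∈ P, x ∈ A) ∧ (∃ A ∈ P, y ∈ A) := by
    intro e he x y h
    have h1 := hNle e x y h
    have h2 := heq e
    rw [if_pos he] at h2
    by_contra hc
    split_ifs at h1 with hx hy hy
    · exact hc ⟨hx, hy⟩
    all_goals omega
  have hsing : ∀ A ∈ P, A.card = 1 := by
    intro A hA
    rcases (cut_eq_three hcubic h4 (hne A hA) (hnec A hA) (hcut3 A hA).le).2 with h | h
    · exact h
    exfalso
    obtain ⟨x, hx⟩ := Finset.card_eq_one.1 h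
    obtain ⟨B, hB, hBA⟩ := Finset.exists_mem_ne (s := P) (by omega) A
    have hxA : ∀ z, z ∉ A ↔ z = x := by
      intro z
      rw [← Finset.mem_compl, hx, Finset.mem_singleton]
    have hxB : x ∈ B := by
      obtain ⟨z, hz⟩ := hne B hB
      have : z ∉ A := fun hzA => hBA (hdisj B hB A hA z hz hzA)
      rwa [← (hxA z).1 this]
    obtain ⟨e, he, hxe⟩ := hiso x
    obtain ⟨y, hy⟩ := Sym2.mem_iff_exists.1 hxe
    have hxy := hadj e he x y hy
    have hyA : y ∈ A := by
      by_contra h'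
      exact hxy.1 ((hxA y).1 h').symm
    have hxS : x ∉ S := hPS B hB x hxB
    exact (hxA x).2 rfl (hclosed A hA y hyA x hxy.symm hxS)
  have hcover : ∀ x, x ∉ S → ∃ A ∈ P, x ∈ A := by
    by_contra! hcon
    obtain ⟨x, hxS, hxP⟩ := hcon
    set R : Finset G.V := Finset.univ.filter fun x => x ∉ S ∧ ∀ A ∈ P, x ∉ A with hR
    have hRmem : ∀ z, z ∈ R ↔ z ∉ S ∧ ∀ A ∈ P, z ∉ A := by simp [hR]
    have hcutR : ∀ e r y, G.ends e = s(r, y) → r ∈ R → y ∈ R := by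
      intro e r y h hr
      rw [hRmem] at hr ⊢
      have he : e ∉ D := fun he => by
        obtain ⟨⟨A, hA, hrA⟩, -⟩ := hDcover e he r y h
        exact hr.2 A hA hrA
      constructor
      · intro hy
        have h1 := hNle e r y h
        have h2 := heq e
        rw [if_neg fun ⟨A, hA, hrA⟩ => hr.2 A hA hrA, if_neg (hSP y hy)] at h1
        rw [if_neg he, incOn_of_ends h, if_pos hy] at h2
        omega
      · intro A hA hy
        exact hr.2 A hA (hclosed A hA y hy r (hadj e he r y h).symm hr.1)
    have hcut0 : G.cut R = ∅ := by
      refine Finset.eq_empty_of_forall_notMem fun e => ?_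
      obtain ⟨r, y, h⟩ := exists_ends e
      rw [mem_cut h, not_not]
      exact ⟨hcutR e r y h, hcutR e y r (by rw [h, Sym2.eq_swap])⟩
    obtain ⟨A, hA⟩ : P.Nonempty := Finset.card_pos.1 (by omega)
    obtain ⟨z, hz⟩ := hne A hA
    have := (cut_eq_three hcubic h4 (A := R) ⟨x, (hRmem x).2 ⟨hxS, hxP⟩⟩
      ⟨z, by rw [Finset.mem_compl, hRmem]; exact fun h => h.2 A hA hz⟩
      (by rw [hcut0]; simp)).1
    rw [hcut0] at this
    simp at this
  refine ⟨by omega, S, ?_⟩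
  ext e
  obtain ⟨x, y, h⟩ := exists_ends e
  rw [mem_cut h, Finset.mem_compl]
  constructor
  · intro hS he
    obtain ⟨⟨A, hA, hxA⟩, ⟨B, hB, hyB⟩⟩ := hDcover e he x y h
    exact hS (iff_of_false (hPS A hA x hxA) (hPS B hB y hyB))
  · intro he hS
    by_cases hx : x ∈ S
    · have h1 := hNle e x y h
      have h2 := heq e
      rw [if_neg (hSP x hx), if_neg (hSP y (hS.1 hx))] at h1
      rw [if_neg he, incOn_of_ends h, if_pos hx] at h2
      omega
    · obtain ⟨A, hA, hxA⟩ := hcover x hx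
      have hxy := hadj e he x y h
      have hyA := hclosed A hA x hxA y hxy (by tauto)
      exact hxy.1 (Finset.card_le_one.1 (hsing A hA).le x hxA y hyA)

/-- For an edge `e` at `u` and a different edge `f`, either some perfect matching contains `e` and
avoids `f`, or the edges other than `f` and the two remaining edges at `u` form an edge-cut. -/
theorem exists_perfectMatching_or_cut_eq (hcubic : G.IsCubic) (h4 : G.CyclicallyEdgeConnected 4)
    (hcard : 4 ≤ Fintype.card G.V) {e f : G.E} {u : G.V} (hu : u ∈ G.ends e) (hef : e ≠ f) :
    (∃ M, G.IsPerfectMatching M ∧ e ∈ M ∧ f ∉ M) ∨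
      f ∉ G.star u ∧ ∃ S, G.cut S = (insert f ((G.star u).erase e))ᶜ := by
  have hstar := card_star hcubic fun e x y => ne_of_ends hcubic h4 hcard
  have herase : ((G.star u).erase e).card = 2 := by
    rw [Finset.card_erase_of_mem (mem_star.2 hu), hstar]
  by_cases hM : ∃ M, G.IsPerfectMatching M ∧ ∀ e' ∈ M, e' ∉ insert f ((G.star u).erase e)
  · left
    obtain ⟨M, hM, hMD⟩ := hM
    refine ⟨M, hM, ?_, fun hf => hMD f hf (Finset.mem_insert_self _ _)⟩
    obtain ⟨e', ⟨he'M, he'u⟩, -⟩ := hM.2 u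
    have := hMD e' he'M
    simp only [Finset.mem_insert, Finset.mem_erase, mem_star, not_or, not_and] at this
    by_cases hee' : e' = e
    · rwa [← hee']
    · exact absurd he'u (this.2 hee')
  · right
    obtain ⟨h3, hS⟩ := cut_eq_compl_of_no_perfectMatching hcubic h4 hcard
      ((Finset.card_insert_le _ _).trans (by rw [herase])) (by
        intro x
        by_cases hxu : x = u
        · exact ⟨e, by simp [hef], hxu ▸ hu⟩
        by_contra! hcon
        have hsub : G.star x ⊆ insert f (G.star x ∩ G.star u) := by
          intro e' he'
          have : e' ∈ insert f ((G.star u).erase e) := by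
            by_contra h
            exact hcon e' h (mem_star.1 he')
          rw [Finset.mem_insert] at this ⊢
          exact this.imp_right fun h =>
            Finset.mem_inter.2 ⟨he', Finset.mem_of_mem_erase h⟩
        have hone : (G.star x ∩ G.star u).card ≤ 1 := by
          refine Finset.card_le_one.2 fun a ha b hb => ?_
          simp only [Finset.mem_inter, mem_star] at ha hb
          exact eq_of_ends hcubic h4 hcard ((Sym2.mem_and_mem_iff hxu).1 ha)
            ((Sym2.mem_and_mem_iff hxu).1 hb)
        have := (Finset.card_le_card hsub).trans (Finset.card_insert_le _ _)
        rw [hstar] at this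
        omega) hM
    refine ⟨fun hf => ?_, hS⟩
    rw [Finset.insert_eq_of_mem (Finset.mem_erase.2 ⟨hef.symm, hf⟩), herase] at h3
    omega

theorem iso_K4_of_card_eq_four (hcubic : G.IsCubic) (h4 : G.CyclicallyEdgeConnected 4)
    (hcard : Fintype.card G.V = 4) : Iso G K4 := by
  let φ : G.V ≃ Fin 4 := Fintype.equivFinOfCardEq hcard
  have hex : ∀ e : G.E, ∃ p : {p : Fin 4 × Fin 4 // p.1 < p.2},
      s(p.1.1, p.1.2) = (G.ends e).map φ := by
    intro e
    obtain ⟨x, y, h⟩ := exists_ends e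
    have hne : φ x ≠ φ y := fun h' => ne_of_ends hcubic h4 hcard.ge h (φ.injective h')
    rcases lt_or_gt_of_ne hne with hlt | hlt
    · exact ⟨⟨(φ x, φ y), hlt⟩, by rw [h, Sym2.map_mk]⟩
    · exact ⟨⟨(φ y, φ x), hlt⟩, by rw [h, Sym2.map_mk, Sym2.eq_swap]⟩
  choose g hg using hex
  have hinj : Function.Injective g := by
    intro a b hab
    have h : G.ends a = G.ends b :=
      Sym2.map.injective φ.injective (by rw [← hg a, ← hg b, hab])
    obtain ⟨x, y, hx⟩ := exists_ends a
    exact eq_of_ends hcubic h4 hcard.ge hx (h ▸ hx)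
  have hE : Fintype.card G.E = 6 := by
    have h1 := sum_incOn hcubic Finset.univ
    have h2 : ∀ e, G.incOn Finset.univ e = 2 := by
      intro e
      obtain ⟨x, y, h⟩ := exists_ends e
      simp [incOn_of_ends h]
    rw [Finset.sum_congr rfl fun e _ => h2 e, Finset.card_univ, hcard] at h1
    simp only [Finset.sum_const, Finset.card_univ, smul_eq_mul] at h1
    omega
  have hK : Fintype.card {p : Fin 4 × Fin 4 // p.1 < p.2} = 6 := by
    rw [Fintype.card_subtype]
    rfl
  have hbij : Function.Bijective g :=
    (Fintype.bijective_iff_injective_and_card g).2 ⟨hinj, hE.trans hK.symm⟩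
  exact ⟨φ, Equiv.ofBijective g hbij, hg⟩

end Multigraph

/-- Every cyclically 4-edge-connected cubic graph with at least
four vertices that is different from `K₄` is matching double-covered. -/
theorem cyclically4ec_matchingDoubleCovered (G : Multigraph)
    (hcubic : G.IsCubic) (h4 : G.CyclicallyEdgeConnected 4)
    (hcard : 4 ≤ Fintype.card G.V) (hK4 : ¬ Iso G K4) :
    G.MatchingDoubleCovered := by
  intro e
  have hcard5 : 5 ≤ Fintype.card G.V := by
    by_contra! h
    exact hK4 (iso_K4_of_card_eq_four hcubic h4 (by omega))
  obtain ⟨u, v, he⟩ := exists_ends e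
  have hu : u ∈ G.ends e := by simp [he]
  obtain ⟨M, hM, heM⟩ : ∃ M, G.IsPerfectMatching M ∧ e ∈ M := by
    obtain ⟨f, hf, hfe⟩ := Finset.exists_mem_ne (s := G.star u)
      (by rw [card_star hcubic fun e x y => ne_of_ends hcubic h4 hcard]; omega) e
    rcases exists_perfectMatching_or_cut_eq hcubic h4 hcard hu hfe.symm with ⟨M, h1, h2, -⟩ | h
    · exact ⟨M, h1, h2⟩
    · exact absurd hf h.1
  suffices h : ∃ M', G.IsPerfectMatching M' ∧ e ∈ M' ∧ M' ≠ M by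
    obtain ⟨M', hM', heM', hne⟩ := h
    exact Finite.one_lt_card_iff_nontrivial.2
      ⟨⟨M', hM', heM'⟩, ⟨M, hM, heM⟩, fun h => hne (congrArg Subtype.val h)⟩
  have hout : ∀ T : Finset G.V, T.card ≤ 4 → ∃ w, w ∉ T := by
    intro T hT
    by_contra! h
    rw [Finset.eq_univ_iff_forall.2 h, Finset.card_univ] at hT
    omega
  obtain ⟨w, hw⟩ := hout {u, v} (Finset.card_le_two.trans (by omega))
  obtain ⟨f, ⟨hfM, hwf⟩, -⟩ := hM.2 w
  obtain ⟨x, hf⟩ := Sym2.mem_iff_exists.1 hwf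
  obtain ⟨z, hz⟩ := hout {u, v, w, x} Finset.card_le_four
  obtain ⟨g, ⟨hgM, hzg⟩, -⟩ := hM.2 z
  simp only [Finset.mem_insert, Finset.mem_singleton, not_or] at hw hz
  have hef : e ≠ f := by
    rintro rfl
    rw [he, Sym2.mem_iff] at hwf
    tauto
  have heg : e ≠ g := by
    rintro rfl
    rw [he, Sym2.mem_iff] at hzg
    tauto
  have hfg : f ≠ g := by
    rintro rfl
    rw [hf, Sym2.mem_iff] at hzg
    tauto
  rcases exists_perfectMatching_or_cut_eq hcubic h4 hcard hu hef with
    ⟨M', h1, h2, h3⟩ | ⟨hfu, S, hS⟩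
  · exact ⟨M', h1, h2, fun h => h3 (h ▸ hfM)⟩
  rcases exists_perfectMatching_or_cut_eq hcubic h4 hcard hu heg with
    ⟨M', h1, h2, h3⟩ | ⟨hgu, T, hT⟩
  · exact ⟨M', h1, h2, fun h => h3 (h ▸ hgM)⟩
  exfalso
  have hfcut : f ∈ G.cut (symmDiff S T) := by
    rw [mem_cut_symmDiff, hS, hT]
    simp [hfg, hfu]
  have hsub : G.cut (symmDiff S T) ⊆ {f, g} := by
    intro a ha
    rw [mem_cut_symmDiff, hS, hT] at ha
    simp only [Finset.mem_compl, Finset.mem_insert, Finset.mem_singleton] at ha ⊢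
    by_contra! h
    simp [h.1, h.2] at ha
  rw [mem_cut hf] at hfcut
  have hle := (Finset.card_le_card hsub).trans Finset.card_le_two
  have hne : (symmDiff S T).Nonempty := by
    rw [Finset.nonempty_iff_ne_empty]
    intro h
    simp [h] at hfcut
  have hnec : (symmDiff S T)ᶜ.Nonempty := by
    rw [Finset.nonempty_iff_ne_empty, Ne, Finset.compl_eq_empty_iff]
    intro h
    simp [h] at hfcut
  have := (cut_eq_three hcubic h4 hne hnec (by omega)).1
  omega
end
end

section
/- Every klee-graph with n vertices has at least 3n/4 − 6 perfect matchings. -/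
open scoped Classical

noncomputable section

namespace KleeModel

/-- A vertex of a cubic graph, given by its three incident edges. -/
abbrev Triple := ℕ × ℕ × ℕ

/-- The edge set coded by the binary digits of `j` contains all three edges of `u`. -/
def full (u : Triple) (j : ℕ) : Bool := j.testBit u.1 && j.testBit u.2.1 && j.testBit u.2.2

/-- The edge set coded by `j` contains one or three edges of `u`. -/
def odd (u : Triple) (j : ℕ) : Bool := j.testBit u.1 ^^ (j.testBit u.2.1 ^^ j.testBit u.2.2)

/-- The number of vertices at which the edge set `j` contains all edges. -/
def fulls (vs : List Triple) (j : ℕ) : ℕ := vs.countP fun u => full u j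

/-- The members of `js` without full vertices. -/
def matchings (vs : List Triple) (js : List ℕ) : List ℕ :=
  js.filter fun j => Nat.beq (fulls vs j) 0

/-- The members of `js` with exactly one full vertex. -/
def claws (vs : List Triple) (js : List ℕ) : List ℕ :=
  js.filter fun j => Nat.beq (fulls vs j) 1

def pms (vs : List Triple) (js : List ℕ) : ℕ := (matchings vs js).length

/-- The number of matchings that contain the edge `e`. -/
def pmsThrough (vs : List Triple) (js : List ℕ) (e : ℕ) : ℕ :=
  (matchings vs js).countP fun j => j.testBit e

/-- The number of members of `js` whose only full vertex is `u`. -/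
def clawsAt (vs : List Triple) (js : List ℕ) (u : Triple) : ℕ :=
  (claws vs js).countP (full u)

def poor (m : ℕ) : ℕ := bif Nat.ble m 1 then 1 else 0

/-- The contribution to the potential of a vertex that is the only full vertex of `t` edge sets
and has `d` incident edges in at most one matching. -/
def weight (t : ℕ) (d : ℕ) : ℕ :=
  match d with
  | 0 => bif Nat.ble t 1 then 1 else 0
  | 1 => bif Nat.ble t 1 then 2 else 0
  | _ => bif Nat.ble t 1 then 5 else bif Nat.ble t 2 then 3 else bif Nat.ble t 3 then 1 else 0

def vertexWeight (vs : List Triple) (js : List ℕ) (u : Triple) : ℕ :=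
  weight (clawsAt vs js u)
    (poor (pmsThrough vs js u.1) + poor (pmsThrough vs js u.2.1) + poor (pmsThrough vs js u.2.2))

def potential (vs : List Triple) (js : List ℕ) : ℕ := (vs.map (vertexWeight vs js)).sum

def positive (vs : List Triple) (js : List ℕ) (u : Triple) : Bool :=
  Nat.ble 1 (clawsAt vs js u) && Nat.ble 1 (pmsThrough vs js u.1) &&
    Nat.ble 1 (pmsThrough vs js u.2.1) && Nat.ble 1 (pmsThrough vs js u.2.2)

/-- The inequality between the number of matchings and the potential that is preserved when a
vertex is replaced by a triangle. -/
def rich (vs : List Triple) (js : List ℕ) : Bool :=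
  Nat.ble 6 (pms vs js) &&
    Nat.ble (2 * potential vs js + 3 * vs.length) (4 * pms vs js + 24) &&
    vs.all (positive vs js)

/-- Add to `j` the edges among `ne`, `ne + 1`, `ne + 2` that are coded by `x`. -/
def extend (ne : ℕ) (j x : ℕ) : ℕ := j ||| x <<< ne

/-- The two extensions of `j` to the graph in which `v` is replaced by a triangle. -/
def children (ne : ℕ) (v : Triple) (j : ℕ) : List ℕ :=
  bif j.testBit v.1 then
    bif j.testBit v.2.1 then [extend ne j 0, extend ne j 7]
    else [extend ne j 1, extend ne j 6]
  else bif j.testBit v.2.1 then [extend ne j 2, extend ne j 5]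
  else [extend ne j 4, extend ne j 3]

/-- Replace the vertex `v` by a triangle. The new edges `ne`, `ne + 1`, `ne + 2` are opposite to
the first, second and third edge of `v`. -/
def truncate (ne : ℕ) (v : Triple) (rest : List Triple) : List Triple :=
  (v.1, ne + 1, ne + 2) :: (v.2.1, ne, ne + 2) :: (v.2.2, ne, ne + 1) :: rest

/-- All ways to single out one member of a list. -/
def picks : List Triple → List (Triple × List Triple)
  | [] => []
  | v :: l => (v, l) :: (picks l).map fun p => (p.1, v :: p.2)

/-- At most `d` rounds of replacing vertices by triangles lead to `rich` graphs. -/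
def good : ℕ → ℕ → List Triple → List ℕ → Bool
  | 0, _, vs, js => rich vs js
  | d + 1, ne, vs, js => rich vs js ||
      (Nat.ble (3 * vs.length) (4 * pms vs js + 24) &&
      (picks vs).all fun p =>
        good d (ne + 3) (truncate ne p.1 p.2) (js.flatMap (children ne p.1)))

/-- The members of `js` code distinct subsets of the edges `0, …, ne - 1` with odd degree at
every vertex. -/
structure Valid (ne : ℕ) (vs : List Triple) (js : List ℕ) : Prop where
  bound : ∀ u ∈ vs, u.1 < ne ∧ u.2.1 < ne ∧ u.2.2 < ne
  distinct : ∀ u ∈ vs, u.1 ≠ u.2.1 ∧ u.1 ≠ u.2.2 ∧ u.2.1 ≠ u.2.2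
  nodup : js.Nodup
  lt : ∀ j ∈ js, j < 2 ^ ne
  odd : ∀ j ∈ js, ∀ u ∈ vs, odd u j = true

lemma testBit_extend_of_lt {ne i : ℕ} (j x : ℕ) (h : i < ne) :
    (extend ne j x).testBit i = j.testBit i := by
  simp [extend, Nat.testBit_shiftLeft, Nat.not_le.mpr h]

lemma testBit_extend_add {ne j : ℕ} (x i : ℕ) (h : j < 2 ^ ne) :
    (extend ne j x).testBit (ne + i) = x.testBit i := by
  have : j.testBit (ne + i) = false :=
    Nat.testBit_lt_two_pow (h.trans_le (Nat.pow_le_pow_right (by norm_num) (by omega)))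
  simp [extend, Nat.testBit_shiftLeft, this]

lemma testBit_extend_self {ne j : ℕ} (x : ℕ) (h : j < 2 ^ ne) :
    (extend ne j x).testBit ne = x.testBit 0 := testBit_extend_add x 0 h

lemma extend_lt {ne j x : ℕ} (h : j < 2 ^ ne) (hx : x < 8) : extend ne j x < 2 ^ (ne + 3) := by
  apply Nat.or_lt_two_pow
  · exact h.trans_le (Nat.pow_le_pow_right (by norm_num) (by omega))
  · rw [Nat.shiftLeft_eq, pow_add]
    nlinarith [Nat.two_pow_pos ne]

lemma extend_inj {ne j j' x x' : ℕ} (h : j < 2 ^ ne) (h' : j' < 2 ^ ne)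
    (e : extend ne j x = extend ne j' x') : j = j' ∧ x = x' := by
  constructor <;> apply Nat.eq_of_testBit_eq <;> intro i
  · rcases lt_or_ge i ne with hi | hi
    · rw [← testBit_extend_of_lt j x hi, e, testBit_extend_of_lt j' x' hi]
    · have := Nat.pow_le_pow_right (n := 2) (by norm_num) hi
      rw [Nat.testBit_lt_two_pow (h.trans_le this), Nat.testBit_lt_two_pow (h'.trans_le this)]
  · rw [← testBit_extend_add x i h, e, testBit_extend_add x' i h']

lemma children_of_odd {v : Triple} {j : ℕ} (ne : ℕ) (h : odd v j = true) :
    (j.testBit v.1 = true ∧ j.testBit v.2.1 = true ∧ j.testBit v.2.2 = true ∧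
      children ne v j = [extend ne j 0, extend ne j 7]) ∨
    (j.testBit v.1 = true ∧ j.testBit v.2.1 = false ∧ j.testBit v.2.2 = false ∧
      children ne v j = [extend ne j 1, extend ne j 6]) ∨
    (j.testBit v.1 = false ∧ j.testBit v.2.1 = true ∧ j.testBit v.2.2 = false ∧
      children ne v j = [extend ne j 2, extend ne j 5]) ∨
    (j.testBit v.1 = false ∧ j.testBit v.2.1 = false ∧ j.testBit v.2.2 = true ∧
      children ne v j = [extend ne j 4, extend ne j 3]) := by
  unfold odd at h
  unfold children
  cases h1 : j.testBit v.1 <;> cases h2 : j.testBit v.2.1 <;> cases h3 : j.testBit v.2.2 <;>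
    simp_all

lemma exists_of_mem_children {ne j k : ℕ} {v : Triple} (h : k ∈ children ne v j) :
    ∃ x < 8, k = extend ne j x := by
  unfold children at h
  cases h1 : j.testBit v.1 <;> cases h2 : j.testBit v.2.1 <;> simp [h1, h2] at h <;>
    rcases h with rfl | rfl <;> exact ⟨_, by norm_num, rfl⟩

lemma odd_extend {ne : ℕ} {u : Triple} (j x : ℕ) (h : u.1 < ne ∧ u.2.1 < ne ∧ u.2.2 < ne) :
    odd u (extend ne j x) = odd u j := by
  simp only [odd, testBit_extend_of_lt _ _ h.1, testBit_extend_of_lt _ _ h.2.1,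
    testBit_extend_of_lt _ _ h.2.2]

lemma full_extend {ne : ℕ} {u : Triple} (j x : ℕ) (h : u.1 < ne ∧ u.2.1 < ne ∧ u.2.2 < ne) :
    full u (extend ne j x) = full u j := by
  simp only [full, testBit_extend_of_lt _ _ h.1, testBit_extend_of_lt _ _ h.2.1,
    testBit_extend_of_lt _ _ h.2.2]

lemma fulls_extend {ne : ℕ} {vs : List Triple} (j x : ℕ)
    (h : ∀ u ∈ vs, u.1 < ne ∧ u.2.1 < ne ∧ u.2.2 < ne) :
    fulls vs (extend ne j x) = fulls vs j :=
  List.countP_congr fun u hu => by rw [full_extend j x (h u hu)]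

namespace Valid

variable {ne : ℕ} {v : Triple} {vs vs' rest : List Triple} {js : List ℕ}

lemma perm (h : Valid ne vs js) (p : vs.Perm vs') : Valid ne vs' js where
  bound u hu := h.bound u (p.mem_iff.2 hu)
  distinct u hu := h.distinct u (p.mem_iff.2 hu)
  nodup := h.nodup
  lt := h.lt
  odd j hj u hu := h.odd j hj u (p.mem_iff.2 hu)

lemma truncate (h : Valid ne (v :: rest) js) :
    Valid (ne + 3) (truncate ne v rest) (js.flatMap (children ne v)) where
  bound u hu := by
    have hv := h.bound v (by simp)
    simp only [KleeModel.truncate, List.mem_cons] at hu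
    rcases hu with rfl | rfl | rfl | hu
    · dsimp only; omega
    · dsimp only; omega
    · dsimp only; omega
    · have := h.bound u (by simp [hu])
      omega
  distinct u hu := by
    have hv := h.bound v (by simp)
    simp only [KleeModel.truncate, List.mem_cons] at hu
    rcases hu with rfl | rfl | rfl | hu
    · dsimp only; omega
    · dsimp only; omega
    · dsimp only; omega
    · exact h.distinct u (by simp [hu])
  nodup := by
    rw [List.nodup_flatMap]
    constructor
    · intro j hj
      have hl := h.lt j hj
      rcases children_of_odd ne (h.odd j hj v (by simp)) with ⟨-, -, -, e⟩ | ⟨-, -, -, e⟩ |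
        ⟨-, -, -, e⟩ | ⟨-, -, -, e⟩ <;> rw [e] <;>
        simp only [List.nodup_cons, List.mem_singleton, List.not_mem_nil, not_false_eq_true,
          List.nodup_nil, and_true] <;>
        exact fun e' => absurd (extend_inj hl hl e').2 (by norm_num)
    · refine h.nodup.pairwise_of_forall_ne fun j hj j' hj' hne => ?_
      intro k hk hk'
      obtain ⟨x, -, rfl⟩ := exists_of_mem_children hk
      obtain ⟨x', -, e⟩ := exists_of_mem_children hk'
      exact hne (extend_inj (h.lt j hj) (h.lt j' hj') e).1
  lt k hk := by
    obtain ⟨j, hj, hk⟩ := List.mem_flatMap.1 hk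
    obtain ⟨x, hx, rfl⟩ := exists_of_mem_children hk
    exact extend_lt (h.lt j hj) hx
  odd k hk u hu := by
    obtain ⟨j, hj, hk⟩ := List.mem_flatMap.1 hk
    have hl := h.lt j hj
    have hv := h.bound v (by simp)
    simp only [KleeModel.truncate, List.mem_cons] at hu
    by_cases hr : u ∈ rest
    · obtain ⟨x, -, rfl⟩ := exists_of_mem_children hk
      rw [odd_extend j x (h.bound u (by simp [hr]))]
      exact h.odd j hj u (by simp [hr])
    · simp only [hr, or_false] at hu
      rcases children_of_odd ne (h.odd j hj v (by simp)) with ⟨h1, h2, h3, e⟩ | ⟨h1, h2, h3, e⟩ |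
        ⟨h1, h2, h3, e⟩ | ⟨h1, h2, h3, e⟩ <;> rw [e] at hk <;>
        simp only [List.mem_cons, List.not_mem_nil, or_false] at hk <;>
        rcases hk with rfl | rfl <;> rcases hu with rfl | rfl | rfl <;>
        simp only [KleeModel.odd, testBit_extend_of_lt _ _ hv.1, testBit_extend_of_lt _ _ hv.2.1,
          testBit_extend_of_lt _ _ hv.2.2, testBit_extend_add _ _ hl, testBit_extend_self _ hl,
          h1, h2, h3] <;> decide

end Valid

lemma countP_add_le_countP_flatMap {p q r : ℕ → Bool} {f : ℕ → List ℕ} {js : List ℕ}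
    (h : ∀ j ∈ js, (q j).toNat + (r j).toNat ≤ (f j).countP p) :
    js.countP q + js.countP r ≤ (js.flatMap f).countP p := by
  induction js with
  | nil => simp
  | cons j js ih =>
    have h1 := h j (by simp)
    have h2 := ih fun k hk => h k (by simp [hk])
    rw [List.flatMap_cons, List.countP_append, List.countP_cons, List.countP_cons]
    cases hq : q j <;> cases hr : r j <;>
      simp only [hq, hr, Bool.toNat_true, Bool.toNat_false, if_true, Bool.false_eq_true,
        if_false] at h1 ⊢ <;> omega

lemma countP_le_countP_flatMap {p q : ℕ → Bool} {f : ℕ → List ℕ} {js : List ℕ}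
    (h : ∀ j ∈ js, (q j).toNat ≤ (f j).countP p) :
    js.countP q ≤ (js.flatMap f).countP p := by
  simpa using countP_add_le_countP_flatMap (r := fun _ => false) (by simpa using h)

lemma pms_eq (vs : List Triple) (js : List ℕ) :
    pms vs js = js.countP fun j => Nat.beq (fulls vs j) 0 := by
  rw [pms, matchings, List.countP_eq_length_filter]

lemma pmsThrough_eq (vs : List Triple) (js : List ℕ) (e : ℕ) :
    pmsThrough vs js e = js.countP fun j => j.testBit e && Nat.beq (fulls vs j) 0 := by
  rw [pmsThrough, matchings, List.countP_filter]

lemma clawsAt_eq (vs : List Triple) (js : List ℕ) (u : Triple) :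
    clawsAt vs js u = js.countP fun j => full u j && Nat.beq (fulls vs j) 1 := by
  rw [clawsAt, claws, List.countP_filter]

section Truncation

variable {ne : ℕ} {v : Triple} {rest : List Triple} {js : List ℕ}

lemma fulls_cons (v : Triple) (rest : List Triple) (j : ℕ) :
    fulls (v :: rest) j = fulls rest j + (full v j).toNat := by
  rw [fulls, fulls, List.countP_cons]
  cases full v j <;> rfl

lemma fulls_truncate_extend {j : ℕ} (x : ℕ) (hj : j < 2 ^ ne)
    (h : ∀ u ∈ v :: rest, u.1 < ne ∧ u.2.1 < ne ∧ u.2.2 < ne) :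
    fulls (truncate ne v rest) (extend ne j x) = fulls rest j +
      (j.testBit v.2.2 && x.testBit 0 && x.testBit 1).toNat +
      (j.testBit v.2.1 && x.testBit 0 && x.testBit 2).toNat +
      (j.testBit v.1 && x.testBit 1 && x.testBit 2).toNat := by
  have hv := h v (by simp)
  rw [truncate, fulls_cons, fulls_cons, fulls_cons,
    fulls_extend j x fun u hu => h u (by simp [hu])]
  simp only [full, testBit_extend_of_lt _ _ hv.1, testBit_extend_of_lt _ _ hv.2.1,
    testBit_extend_of_lt _ _ hv.2.2, testBit_extend_add _ _ hj, testBit_extend_self _ hj]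

lemma one_le_fulls {j : ℕ} {u : Triple} (hu : u ∈ rest) (h : full u j = true) :
    1 ≤ fulls rest j := List.countP_pos_iff.2 ⟨u, hu, h⟩

lemma le_pms_truncate (h : Valid ne (v :: rest) js) :
    pms (v :: rest) js + clawsAt (v :: rest) js v ≤
      pms (truncate ne v rest) (js.flatMap (children ne v)) := by
  rw [pms_eq, pms_eq, clawsAt_eq]
  refine countP_add_le_countP_flatMap fun j hj => ?_
  have hl := h.lt j hj
  rcases children_of_odd ne (h.odd j hj v (by simp)) with ⟨h1, h2, h3, e⟩ | ⟨h1, h2, h3, e⟩ |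
    ⟨h1, h2, h3, e⟩ | ⟨h1, h2, h3, e⟩ <;>
    simp only [e, List.countP_cons, List.countP_nil, fulls_truncate_extend _ hl h.bound,
      fulls_cons v, full, h1, h2, h3] <;>
    generalize fulls rest j = r <;> rcases r with _ | _ | r <;> simp [Nat.testBit, Nat.beq]

lemma le_pmsThrough_truncate (h : Valid ne (v :: rest) js) (i : ℕ) :
    pmsThrough (v :: rest) js i ≤
      pmsThrough (truncate ne v rest) (js.flatMap (children ne v)) i := by
  rw [pmsThrough_eq, pmsThrough_eq]
  refine countP_le_countP_flatMap fun j hj => ?_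
  have hl := h.lt j hj
  rcases lt_or_ge i ne with hi | hi
  · rcases children_of_odd ne (h.odd j hj v (by simp)) with ⟨h1, h2, h3, e⟩ | ⟨h1, h2, h3, e⟩ |
      ⟨h1, h2, h3, e⟩ | ⟨h1, h2, h3, e⟩ <;>
      simp only [e, List.countP_cons, List.countP_nil, fulls_truncate_extend _ hl h.bound,
        fulls_cons v, full, h1, h2, h3, testBit_extend_of_lt _ _ hi] <;>
      cases j.testBit i <;>
      generalize fulls rest j = r <;> rcases r with _ | _ | r <;> simp [Nat.testBit, Nat.beq]
  · simp [Nat.testBit_lt_two_pow (hl.trans_le (Nat.pow_le_pow_right (by norm_num) hi))]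

lemma le_pmsThrough_truncate_of_mem (h : Valid ne (v :: rest) js) {i : ℕ}
    (hi : i = v.1 ∨ i = v.2.1 ∨ i = v.2.2) :
    pmsThrough (v :: rest) js i + clawsAt (v :: rest) js v ≤
      pmsThrough (truncate ne v rest) (js.flatMap (children ne v)) i := by
  rw [pmsThrough_eq, pmsThrough_eq, clawsAt_eq]
  refine countP_add_le_countP_flatMap fun j hj => ?_
  have hl := h.lt j hj
  have hv := h.bound v (by simp)
  rcases hi with rfl | rfl | rfl <;>
  rcases children_of_odd ne (h.odd j hj v (by simp)) with ⟨h1, h2, h3, e⟩ | ⟨h1, h2, h3, e⟩ |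
    ⟨h1, h2, h3, e⟩ | ⟨h1, h2, h3, e⟩ <;>
    simp only [e, List.countP_cons, List.countP_nil, fulls_truncate_extend _ hl h.bound,
      fulls_cons v, full, h1, h2, h3, testBit_extend_of_lt _ _ hv.1,
      testBit_extend_of_lt _ _ hv.2.1, testBit_extend_of_lt _ _ hv.2.2] <;>
    generalize fulls rest j = r <;> rcases r with _ | _ | r <;> simp [Nat.testBit, Nat.beq]

lemma le_pmsThrough_truncate_new (h : Valid ne (v :: rest) js) :
    pmsThrough (v :: rest) js v.1 ≤
        pmsThrough (truncate ne v rest) (js.flatMap (children ne v)) ne ∧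
      pmsThrough (v :: rest) js v.2.1 ≤
        pmsThrough (truncate ne v rest) (js.flatMap (children ne v)) (ne + 1) ∧
      pmsThrough (v :: rest) js v.2.2 ≤
        pmsThrough (truncate ne v rest) (js.flatMap (children ne v)) (ne + 2) := by
  simp only [pmsThrough_eq]
  refine ⟨countP_le_countP_flatMap fun j hj => ?_, countP_le_countP_flatMap fun j hj => ?_,
    countP_le_countP_flatMap fun j hj => ?_⟩ <;>
  have hl := h.lt j hj <;>
  rcases children_of_odd ne (h.odd j hj v (by simp)) with ⟨h1, h2, h3, e⟩ | ⟨h1, h2, h3, e⟩ |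
    ⟨h1, h2, h3, e⟩ | ⟨h1, h2, h3, e⟩ <;>
    simp only [e, List.countP_cons, List.countP_nil, fulls_truncate_extend _ hl h.bound,
      fulls_cons v, full, h1, h2, h3, testBit_extend_add _ _ hl, testBit_extend_self _ hl] <;>
    generalize fulls rest j = r <;> rcases r with _ | _ | r <;> simp [Nat.testBit, Nat.beq]

lemma le_clawsAt_truncate (h : Valid ne (v :: rest) js) {u : Triple} (hu : u ∈ rest) :
    clawsAt (v :: rest) js u ≤
      clawsAt (truncate ne v rest) (js.flatMap (children ne v)) u := by
  rw [clawsAt_eq, clawsAt_eq]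
  refine countP_le_countP_flatMap fun j hj => ?_
  have hl := h.lt j hj
  have hb := h.bound u (by simp [hu])
  have hf := one_le_fulls (j := j) hu
  rcases children_of_odd ne (h.odd j hj v (by simp)) with ⟨h1, h2, h3, e⟩ | ⟨h1, h2, h3, e⟩ |
    ⟨h1, h2, h3, e⟩ | ⟨h1, h2, h3, e⟩ <;>
    simp only [e, List.countP_cons, List.countP_nil, fulls_truncate_extend _ hl h.bound,
      fulls_cons v, full_extend _ _ hb] <;>
    rw [full.eq_1 v] <;> simp only [h1, h2, h3] <;>
    revert hf <;> cases full u j <;>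
    generalize fulls rest j = r <;> rcases r with _ | _ | r <;> simp [Nat.testBit, Nat.beq]

lemma le_clawsAt_truncate_new (h : Valid ne (v :: rest) js) :
    pmsThrough (v :: rest) js v.1 ≤
        clawsAt (truncate ne v rest) (js.flatMap (children ne v)) (v.1, ne + 1, ne + 2) ∧
      pmsThrough (v :: rest) js v.2.1 ≤
        clawsAt (truncate ne v rest) (js.flatMap (children ne v)) (v.2.1, ne, ne + 2) ∧
      pmsThrough (v :: rest) js v.2.2 ≤
        clawsAt (truncate ne v rest) (js.flatMap (children ne v)) (v.2.2, ne, ne + 1) := by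
  have hv := h.bound v (by simp)
  simp only [pmsThrough_eq, clawsAt_eq]
  refine ⟨countP_le_countP_flatMap fun j hj => ?_, countP_le_countP_flatMap fun j hj => ?_,
    countP_le_countP_flatMap fun j hj => ?_⟩ <;>
  have hl := h.lt j hj <;>
  rcases children_of_odd ne (h.odd j hj v (by simp)) with ⟨h1, h2, h3, e⟩ | ⟨h1, h2, h3, e⟩ |
    ⟨h1, h2, h3, e⟩ | ⟨h1, h2, h3, e⟩ <;>
    simp only [e, List.countP_cons, List.countP_nil, fulls_truncate_extend _ hl h.bound,
      fulls_cons v, full, h1, h2, h3, testBit_extend_add _ _ hl, testBit_extend_self _ hl,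
      testBit_extend_of_lt _ _ hv.1, testBit_extend_of_lt _ _ hv.2.1,
      testBit_extend_of_lt _ _ hv.2.2] <;>
    generalize fulls rest j = r <;> rcases r with _ | _ | r <;> simp [Nat.testBit, Nat.beq]

lemma pms_le_sum (h : Valid ne (v :: rest) js) :
    pms (v :: rest) js ≤ pmsThrough (v :: rest) js v.1 + pmsThrough (v :: rest) js v.2.1 +
      pmsThrough (v :: rest) js v.2.2 := by
  have ho : ∀ j ∈ matchings (v :: rest) js, odd v j = true := fun j hj =>
    h.odd j (List.mem_filter.1 hj).1 v (by simp)
  simp only [pms, pmsThrough]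
  revert ho
  generalize matchings (v :: rest) js = l
  intro ho
  induction l with
  | nil => simp
  | cons j l ih =>
    have h1 := ih fun k hk => ho k (by simp [hk])
    have h2 := ho j (by simp)
    simp only [List.length_cons, List.countP_cons]
    rcases children_of_odd ne h2 with ⟨h1, h2, h3, -⟩ | ⟨h1, h2, h3, -⟩ |
      ⟨h1, h2, h3, -⟩ | ⟨h1, h2, h3, -⟩ <;> simp only [h1, h2, h3, if_true, Bool.false_eq_true,
        if_false] <;> omega

lemma poor_anti {m m' : ℕ} (h : m ≤ m') : poor m' ≤ poor m := by
  simp only [poor, Bool.cond_eq_ite, Nat.ble_eq]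
  split_ifs <;> omega

lemma weight_anti {t t' d d' : ℕ} (ht : t ≤ t') (hd : d' ≤ d) : weight t' d' ≤ weight t d := by
  rcases d with _ | _ | d <;> rcases d' with _ | _ | d' <;>
    simp only [weight, Bool.cond_eq_ite, Nat.ble_eq] <;> split_ifs <;> omega

lemma weight_step {t a b c : ℕ} (ht : 1 ≤ t) (ha : 1 ≤ a) (hb : 1 ≤ b) (hc : 1 ≤ c)
    (h : 6 ≤ a + b + c) :
    weight a (poor b + poor c) + weight b (poor a + poor c) + weight c (poor a + poor b) + 3 ≤
      weight t (poor a + poor b + poor c) + 2 * t := by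
  have hp : ∀ m, 1 ≤ m → (m = 1 ∧ poor m = 1) ∨ (2 ≤ m ∧ poor m = 0) := by
    intro m hm
    simp only [poor, Bool.cond_eq_ite, Nat.ble_eq]
    split_ifs <;> omega
  rcases hp a ha with ⟨ha, pa⟩ | ⟨ha, pa⟩ <;> rcases hp b hb with ⟨hb, pb⟩ | ⟨hb, pb⟩ <;>
    rcases hp c hc with ⟨hc, pc⟩ | ⟨hc, pc⟩ <;>
    simp only [pa, pb, pc, weight, Bool.cond_eq_ite, Nat.ble_eq] <;> split_ifs <;> omega

lemma positive_iff {vs : List Triple} {u : Triple} : positive vs js u = true ↔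
    1 ≤ clawsAt vs js u ∧ 1 ≤ pmsThrough vs js u.1 ∧ 1 ≤ pmsThrough vs js u.2.1 ∧
      1 ≤ pmsThrough vs js u.2.2 := by
  simp [positive, Nat.ble_eq, and_assoc]

lemma rich_iff {vs : List Triple} : rich vs js = true ↔
    6 ≤ pms vs js ∧ 2 * potential vs js + 3 * vs.length ≤ 4 * pms vs js + 24 ∧
      ∀ u ∈ vs, positive vs js u = true := by
  simp [rich, Nat.ble_eq, and_assoc]

theorem rich_truncate (h : Valid ne (v :: rest) js) (hr : rich (v :: rest) js = true) :
    rich (truncate ne v rest) (js.flatMap (children ne v)) = true := by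
  rw [rich_iff] at hr ⊢
  obtain ⟨h6, hpot, hpos⟩ := hr
  have hm := le_pms_truncate h
  have hsum := pms_le_sum h
  have hold := le_pmsThrough_truncate h
  have hinc := fun i => le_pmsThrough_truncate_of_mem h (i := i)
  have hx := hinc v.1 (by simp)
  have hy := hinc v.2.1 (by simp)
  have hz := hinc v.2.2 (by simp)
  obtain ⟨hf1, hf2, hf3⟩ := le_pmsThrough_truncate_new h
  have hcl := fun u => le_clawsAt_truncate h (u := u)
  obtain ⟨hc1, hc2, hc3⟩ := le_clawsAt_truncate_new h
  obtain ⟨p0, p1, p2, p3⟩ := positive_iff.1 (hpos v (by simp))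
  have hposr : ∀ u ∈ rest, 1 ≤ clawsAt (v :: rest) js u ∧ 1 ≤ pmsThrough (v :: rest) js u.1 ∧
      1 ≤ pmsThrough (v :: rest) js u.2.1 ∧ 1 ≤ pmsThrough (v :: rest) js u.2.2 :=
    fun u hu => positive_iff.1 (hpos u (by simp [hu]))
  clear hpos
  have hlen : (truncate ne v rest).length = rest.length + 3 := rfl
  have hsplit : potential (truncate ne v rest) (js.flatMap (children ne v)) =
      vertexWeight (truncate ne v rest) (js.flatMap (children ne v)) (v.1, ne + 1, ne + 2) +
      (vertexWeight (truncate ne v rest) (js.flatMap (children ne v)) (v.2.1, ne, ne + 2) +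
      (vertexWeight (truncate ne v rest) (js.flatMap (children ne v)) (v.2.2, ne, ne + 1) +
      (rest.map
        (vertexWeight (truncate ne v rest) (js.flatMap (children ne v)))).sum)) := rfl
  have hsplit' : potential (v :: rest) js = vertexWeight (v :: rest) js v +
      (rest.map (vertexWeight (v :: rest) js)).sum := rfl
  have hrest : (rest.map
      (vertexWeight (truncate ne v rest) (js.flatMap (children ne v)))).sum ≤
      (rest.map (vertexWeight (v :: rest) js)).sum :=
    List.sum_le_sum fun u hu => weight_anti (hcl u hu) (add_le_add (add_le_add
      (poor_anti (hold _)) (poor_anti (hold _))) (poor_anti (hold _)))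
  have hposn : ∀ u ∈ truncate ne v rest,
      positive (truncate ne v rest) (js.flatMap (children ne v)) u = true := by
    intro u hu
    rw [positive_iff]
    simp only [truncate, List.mem_cons] at hu
    rcases hu with rfl | rfl | rfl | hu
    · dsimp only; omega
    · dsimp only; omega
    · dsimp only; omega
    · have := hposr u hu
      have := hcl u hu
      have := hold u.1
      have := hold u.2.1
      have := hold u.2.2
      omega
  refine ⟨by omega, ?_, hposn⟩
  have key := weight_step p0 p1 p2 p3 (h6.trans hsum)
  have rich_old : ∀ m : ℕ, 2 ≤ m → poor m = 0 := by
    intro m hm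
    simp only [poor, Bool.cond_eq_ite, Nat.ble_eq]
    split_ifs <;> omega
  have w1 : vertexWeight (truncate ne v rest) (js.flatMap (children ne v)) (v.1, ne + 1, ne + 2) ≤
      weight (pmsThrough (v :: rest) js v.1)
        (poor (pmsThrough (v :: rest) js v.2.1) + poor (pmsThrough (v :: rest) js v.2.2)) := by
    refine weight_anti hc1 ?_
    have := rich_old _ (by omega :
      2 ≤ pmsThrough (truncate ne v rest) (js.flatMap (children ne v)) v.1)
    have := poor_anti hf2
    have := poor_anti hf3
    dsimp only
    omega
  have w2 : vertexWeight (truncate ne v rest) (js.flatMap (children ne v)) (v.2.1, ne, ne + 2) ≤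
      weight (pmsThrough (v :: rest) js v.2.1)
        (poor (pmsThrough (v :: rest) js v.1) + poor (pmsThrough (v :: rest) js v.2.2)) := by
    refine weight_anti hc2 ?_
    have := rich_old _ (by omega :
      2 ≤ pmsThrough (truncate ne v rest) (js.flatMap (children ne v)) v.2.1)
    have := poor_anti hf1
    have := poor_anti hf3
    dsimp only
    omega
  have w3 : vertexWeight (truncate ne v rest) (js.flatMap (children ne v)) (v.2.2, ne, ne + 1) ≤
      weight (pmsThrough (v :: rest) js v.2.2)
        (poor (pmsThrough (v :: rest) js v.1) + poor (pmsThrough (v :: rest) js v.2.1)) := by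
    refine weight_anti hc3 ?_
    have := rich_old _ (by omega :
      2 ≤ pmsThrough (truncate ne v rest) (js.flatMap (children ne v)) v.2.2)
    have := poor_anti hf1
    have := poor_anti hf2
    dsimp only
    omega
  have hw : vertexWeight (v :: rest) js v = weight (clawsAt (v :: rest) js v)
    (poor (pmsThrough (v :: rest) js v.1) + poor (pmsThrough (v :: rest) js v.2.1) +
      poor (pmsThrough (v :: rest) js v.2.2)) := rfl
  rw [List.length_cons] at hpot
  omega

end Truncation

lemma fulls_perm {vs vs' : List Triple} (p : vs.Perm vs') : fulls vs = fulls vs' :=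
  funext fun _ => p.countP_eq _

lemma rich_perm {vs vs' : List Triple} {js : List ℕ} (p : vs.Perm vs')
    (h : rich vs js = true) : rich vs' js = true := by
  have hpms : pms vs js = pms vs' js := by rw [pms_eq, pms_eq, fulls_perm p]
  have hthrough : pmsThrough vs js = pmsThrough vs' js := by
    funext e; rw [pmsThrough_eq, pmsThrough_eq, fulls_perm p]
  have hclaws : clawsAt vs js = clawsAt vs' js := by
    funext u; rw [clawsAt_eq, clawsAt_eq, fulls_perm p]
  have hw : vertexWeight vs js = vertexWeight vs' js := by
    funext u; simp only [vertexWeight, hthrough, hclaws]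
  have hpot : potential vs js = potential vs' js := by
    rw [potential, potential, hw]; exact (p.map _).sum_eq
  rw [rich_iff] at h ⊢
  rw [← hpms, ← hpot, ← p.length_eq]
  refine ⟨h.1, h.2.1, fun u hu => ?_⟩
  have := h.2.2 u (p.mem_iff.2 hu)
  rwa [positive_iff, hthrough, hclaws, ← positive_iff] at this

lemma exists_mem_picks {u : Triple} {vs : List Triple} (h : u ∈ vs) :
    ∃ rest, (u, rest) ∈ picks vs ∧ vs.Perm (u :: rest) := by
  induction vs with
  | nil => simp at h
  | cons v l ih =>
    rcases List.mem_cons.1 h with rfl | h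
    · exact ⟨l, by simp [picks], .refl _⟩
    · obtain ⟨r, hr, p⟩ := ih h
      exact ⟨v :: r, by simp [picks, hr], (p.cons v).trans (.swap _ _ _)⟩

lemma bound_of_good {d ne : ℕ} {vs : List Triple} {js : List ℕ} (h : good d ne vs js = true) :
    3 * vs.length ≤ 4 * pms vs js + 24 := by
  have hr : rich vs js = true → 3 * vs.length ≤ 4 * pms vs js + 24 := by
    rw [rich_iff]; omega
  cases d with
  | zero => exact hr h
  | succ d =>
    simp only [good, Bool.or_eq_true, Bool.and_eq_true, Nat.ble_eq] at h
    exact h.elim hr fun h => h.1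

lemma good_truncate {d ne : ℕ} {vs : List Triple} {js : List ℕ} {u : Triple}
    (hv : Valid ne vs js) (h : good d ne vs js = true) (hu : u ∈ vs) :
    ∃ rest d', vs.Perm (u :: rest) ∧
      Valid (ne + 3) (truncate ne u rest) (js.flatMap (children ne u)) ∧
      good d' (ne + 3) (truncate ne u rest) (js.flatMap (children ne u)) = true := by
  obtain ⟨rest, hp, p⟩ := exists_mem_picks hu
  have hv' := hv.perm p
  have hr : rich vs js = true →
      good 0 (ne + 3) (truncate ne u rest) (js.flatMap (children ne u)) = true :=
    fun h => rich_truncate hv' (rich_perm p h)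
  cases d with
  | zero => exact ⟨rest, 0, p, hv'.truncate, hr h⟩
  | succ d =>
    simp only [good, Bool.or_eq_true, Bool.and_eq_true, List.all_eq_true] at h
    rcases h with h | ⟨-, h⟩
    · exact ⟨rest, 0, p, hv'.truncate, hr h⟩
    · exact ⟨rest, d, p, hv'.truncate, h _ hp⟩

/-- The edges incident with `v`. -/
def incident (G : Multigraph) (v : G.V) : Finset G.E := {e | v ∈ G.ends e}

lemma mem_incident {G : Multigraph} {v : G.V} {e : G.E} : e ∈ incident G v ↔ v ∈ G.ends e := by
  simp [incident]

def edgeSet (u : Triple) : Finset ℕ := {u.1, u.2.1, u.2.2}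

/-- The edges of `G` can be numbered from `0` to `ne - 1` such that `vs` lists the edges at
each vertex. -/
def Represents (G : Multigraph) (ne : ℕ) (vs : List Triple) : Prop :=
  (∀ e, ¬ (G.ends e).IsDiag) ∧ ∃ g : G.E ≃ Fin ne,
    (Finset.univ.val.map fun v => (incident G v).image fun e => (g e : ℕ)) = ↑(vs.map edgeSet)

lemma existsUnique_testBit {u : Triple} {j : ℕ} (ho : odd u j = true) (hf : full u j = false) :
    ∃! n, n ∈ edgeSet u ∧ j.testBit n = true := by
  rcases children_of_odd 0 ho with ⟨h1, h2, h3, -⟩ | ⟨h1, h2, h3, -⟩ | ⟨h1, h2, h3, -⟩ |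
    ⟨h1, h2, h3, -⟩
  · simp [full, h1, h2, h3] at hf
  · refine ⟨u.1, by simp [edgeSet, h1], ?_⟩
    rintro n ⟨hn, h⟩
    simp only [edgeSet, Finset.mem_insert, Finset.mem_singleton] at hn
    rcases hn with rfl | rfl | rfl <;> simp_all
  · refine ⟨u.2.1, by simp [edgeSet, h2], ?_⟩
    rintro n ⟨hn, h⟩
    simp only [edgeSet, Finset.mem_insert, Finset.mem_singleton] at hn
    rcases hn with rfl | rfl | rfl <;> simp_all
  · refine ⟨u.2.2, by simp [edgeSet, h3], ?_⟩
    rintro n ⟨hn, h⟩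
    simp only [edgeSet, Finset.mem_insert, Finset.mem_singleton] at hn
    rcases hn with rfl | rfl | rfl <;> simp_all

namespace Represents

variable {G H : Multigraph} {ne : ℕ} {vs vs' : List Triple} {js : List ℕ}

lemma card_eq (h : Represents G ne vs) : Fintype.card G.V = vs.length := by
  obtain ⟨-, g, h⟩ := h
  simpa using congrArg Multiset.card h

lemma iso (h : Represents G ne vs) (hi : Multigraph.Iso G H) : Represents H ne vs := by
  obtain ⟨hl, g, h⟩ := h
  obtain ⟨f, k, hk⟩ := hi
  refine ⟨fun e => ?_, k.symm.trans g, ?_⟩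
  · obtain ⟨e, rfl⟩ := k.surjective e
    rw [hk, Sym2.isDiag_map f.injective]
    exact hl e
  · rw [← h, ← Finset.map_univ_equiv f, Finset.map_val, Multiset.map_map]
    refine Multiset.map_congr rfl fun v _ => ?_
    ext n
    simp only [incident, Function.comp, Finset.mem_image, Finset.mem_filter, Finset.mem_univ,
      true_and, Equiv.coe_toEmbedding, Equiv.trans_apply]
    constructor
    · rintro ⟨e, he, rfl⟩
      obtain ⟨e, rfl⟩ := k.surjective e
      rw [hk, Sym2.mem_map] at he
      obtain ⟨w, hw, e'⟩ := he
      exact ⟨e, f.injective e' ▸ hw, by simp⟩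
    · rintro ⟨e, he, rfl⟩
      exact ⟨k e, by rw [hk, Sym2.mem_map]; exact ⟨v, he, rfl⟩, by simp⟩

lemma rename (h : Represents G ne vs) (l : List ℕ) (hlt : ∀ i < ne, l.getD i 0 < ne)
    (hinj : ∀ i < ne, ∀ k < ne, l.getD i 0 = l.getD k 0 → i = k)
    (hp : ((vs.map fun u => (edgeSet u).image fun i => l.getD i 0 : List (Finset ℕ)) :
      Multiset (Finset ℕ)) = ↑(vs'.map edgeSet)) :
    Represents G ne vs' := by
  obtain ⟨hl, g, h⟩ := h
  have hb : Function.Bijective fun i : Fin ne => (⟨l.getD i 0, hlt i i.2⟩ : Fin ne) :=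
    Finite.injective_iff_bijective.1 fun i k e =>
      Fin.ext (hinj i i.2 k k.2 (Fin.ext_iff.1 e))
  refine ⟨hl, g.trans (Equiv.ofBijective _ hb), ?_⟩
  rw [← hp, ← Function.comp_def (fun s : Finset ℕ => s.image fun i => l.getD i 0),
    ← List.map_map, ← Multiset.map_coe, ← h, Multiset.map_map]
  refine Multiset.map_congr rfl fun v _ => ?_
  simp only [Function.comp_def, Finset.image_image, Equiv.trans_apply, Equiv.ofBijective_apply]

lemma pms_le (h : Represents G ne vs) (hv : Valid ne vs js) : pms vs js ≤ G.pmCount := by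
  obtain ⟨hl, g, h⟩ := h
  have hmem : ∀ v : G.V, ∃ u ∈ vs, edgeSet u = (incident G v).image fun e => (g e : ℕ) := by
    intro v
    have : (incident G v).image (fun e => (g e : ℕ)) ∈ (↑(vs.map edgeSet) : Multiset _) :=
      h ▸ Multiset.mem_map_of_mem _ (Finset.mem_univ v)
    simpa using this
  have hnd : (matchings vs js).Nodup := hv.nodup.filter _
  rw [pms, ← List.toFinset_card_of_nodup hnd, Multigraph.pmCount, Nat.card_eq_fintype_card,
    Fintype.card_subtype]
  refine Finset.card_le_card_of_injOn
    (fun j => Finset.univ.filter fun e : G.E => j.testBit (g e) = true) ?_ ?_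
  · intro j hj
    simp only [Finset.mem_coe, List.mem_toFinset, matchings, List.mem_filter] at hj
    simp only [Finset.coe_filter, Finset.mem_univ, true_and, Set.mem_ofPred_eq]
    refine ⟨fun e _ => hl e, fun v => ?_⟩
    obtain ⟨u, hu, e⟩ := hmem v
    have hf : full u j = false := by
      by_contra hf
      have := one_le_fulls hu (by simpa using hf)
      have := Nat.eq_of_beq_eq_true hj.2
      omega
    obtain ⟨n, ⟨hn, hjn⟩, huniq⟩ := existsUnique_testBit (hv.odd j hj.1 u hu) hf
    rw [e] at hn
    obtain ⟨k, hk, rfl⟩ := Finset.mem_image.1 hn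
    refine ⟨k, by simpa [incident, hjn] using hk, fun k' hk' => ?_⟩
    have := huniq (g k') (by
      rw [e]
      exact ⟨Finset.mem_image_of_mem _ (by simpa [incident] using hk'.2), by simpa using hk'.1⟩)
    exact g.injective (Fin.ext this)
  · intro j hj j' hj' e
    simp only [Finset.mem_coe, List.mem_toFinset, matchings, List.mem_filter] at hj hj'
    apply Nat.eq_of_testBit_eq
    intro i
    rcases lt_or_ge i ne with hi | hi
    · have := Finset.ext_iff.1 e (g.symm ⟨i, hi⟩)
      simp only [Finset.mem_filter, Finset.mem_univ, true_and, Equiv.apply_symm_apply] at this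
      rwa [Bool.eq_iff_iff]
    · have := Nat.pow_le_pow_right (n := 2) (by norm_num) hi
      rw [Nat.testBit_lt_two_pow ((hv.lt j hj.1).trans_le this),
        Nat.testBit_lt_two_pow ((hv.lt j' hj'.1).trans_le this)]

end Represents

section Expansion

open Multigraph

variable {G : Multigraph} {v : G.V} {σ : G.E → G.V → Fin 3}

lemma not_isDiag_expandTriangles {S : Set G.V} (hl : ∀ e, ¬ (G.ends e).IsDiag)
    (e : (expandTriangles G S σ).E) : ¬ ((expandTriangles G S σ).ends e).IsDiag := by
  rcases e with e | ⟨w, i⟩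
  · simp only [expandTriangles]
    rw [Sym2.isDiag_map]
    · exact hl e
    · intro x y h
      dsimp only at h
      split_ifs at h <;> simp_all
  · simp only [expandTriangles, Sym2.mk_isDiag_iff, Sum.inr.injEq, Prod.mk.injEq, true_and]
    revert i
    decide

lemma inl_mem_ends_inl {S : Set G.V} {x : {x : G.V // x ∉ S}} {e : G.E} :
    (Sum.inl x : (expandTriangles G S σ).V) ∈ (expandTriangles G S σ).ends (Sum.inl e) ↔
      x.1 ∈ G.ends e := by
  refine Sym2.mem_map.trans ?_
  constructor
  · rintro ⟨y, hy, h⟩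
    split_ifs at h with hS
    cases h
    exact hy
  · exact fun h => ⟨x, h, by simp [x.2]⟩

lemma inl_not_mem_ends_inr {S : Set G.V} {x : {x : G.V // x ∉ S}} {k : S × Fin 3} :
    (Sum.inl x : (expandTriangles G S σ).V) ∉ (expandTriangles G S σ).ends (Sum.inr k) :=
  fun h => by rcases Sym2.mem_iff.1 h with h | h <;> cases h

lemma inr_mem_ends_inl {S : Set G.V} {w : S} {i : Fin 3} {e : G.E} :
    (Sum.inr (w, i) : (expandTriangles G S σ).V) ∈ (expandTriangles G S σ).ends (Sum.inl e) ↔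
      w.1 ∈ G.ends e ∧ σ e w.1 = i := by
  refine Sym2.mem_map.trans ?_
  constructor
  · rintro ⟨y, hy, h⟩
    split_ifs at h with hS
    simp only [Sum.inr.injEq, Prod.mk.injEq] at h
    obtain ⟨rfl, rfl⟩ := h
    exact ⟨hy, rfl⟩
  · rintro ⟨h, rfl⟩
    exact ⟨w, h, by simp [w.2]⟩

lemma inr_mem_ends_inr {S : Set G.V} {w w' : S} {i k : Fin 3} :
    (Sum.inr (w, i) : (expandTriangles G S σ).V) ∈
      (expandTriangles G S σ).ends (Sum.inr (w', k)) ↔ w = w' ∧ i ≠ k := by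
  have : ∀ i k : Fin 3, (i = k + 1 ∨ i = k + 2) ↔ i ≠ k := by decide
  refine Sym2.mem_iff.trans ?_
  simp only [Sum.inr.injEq, Prod.mk.injEq, ← and_or_left, this]

/-- The numbering of the edges of the expanded graph that numbers the edge opposite to the
triangle vertex `τ i` by `ne + i`. -/
def expandNumbering {ne : ℕ} (g : G.E ≃ Fin ne) (τ : Fin 3 ≃ Fin 3) :
    (expandTriangles G {v} σ).E ≃ Fin (ne + 3) :=
  (Equiv.sumCongr g ((Equiv.uniqueProd (Fin 3) ({v} : Set G.V)).trans τ.symm)).trans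
    finSumFinEquiv

lemma expandNumbering_inr {ne : ℕ} (g : G.E ≃ Fin ne) (τ : Fin 3 ≃ Fin 3)
    (k : ({v} : Set G.V) × Fin 3) :
    (expandNumbering (v := v) (σ := σ) g τ (Sum.inr k) : ℕ) = ne + τ.symm k.2 :=
  rfl

lemma univ_expandTriangles (F : (expandTriangles G {v} σ).V → Finset ℕ) (τ : Fin 3 ≃ Fin 3)
    (f : G.V → Finset ℕ) (hf : ∀ x : {x : G.V // x ∉ ({v} : Set G.V)}, F (Sum.inl x) = f x) :
    (Finset.univ.val.map F) =
      (Finset.univ.val.map fun i => F (Sum.inr (⟨v, Set.mem_singleton v⟩, τ i))) +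
        (Finset.univ.erase v).val.map f := by
  let e : Fin 3 ⊕ {x : G.V // x ∉ ({v} : Set G.V)} ≃ (expandTriangles G {v} σ).V :=
    (Equiv.sumComm _ _).trans (Equiv.sumCongr (Equiv.refl _)
      (τ.trans (Equiv.uniqueProd (Fin 3) ({v} : Set G.V)).symm))
  rw [← Finset.map_univ_equiv e, Finset.map_val, Multiset.map_map,
    ← Finset.univ_disjSum_univ, Finset.val_disjSum, Multiset.disjSum, Multiset.map_add,
    Multiset.map_map, Multiset.map_map]
  congr 1
  have : (Finset.univ.erase v : Finset G.V) =
      (Finset.univ : Finset {x : G.V // x ∉ ({v} : Set G.V)}).map (.subtype _) := by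
    ext x; simp
  rw [this, Finset.map_val, Multiset.map_map]
  exact Multiset.map_congr rfl fun x _ => hf x

lemma exists_equiv_of_injOn {ne : ℕ} {u : Triple} {g : G.E ≃ Fin ne}
    (hd : u.1 ≠ u.2.1 ∧ u.1 ≠ u.2.2 ∧ u.2.1 ≠ u.2.2)
    (hu : ((incident G v).image fun e => (g e : ℕ)) = edgeSet u)
    (hσ : Set.InjOn (fun e => σ e v) {e : G.E | v ∈ G.ends e}) :
    ∃ τ : Fin 3 ≃ Fin 3, ∀ n, ∀ i,
      (∃ e, (v ∈ G.ends e ∧ σ e v = τ i) ∧ (g e : ℕ) = n) ↔ n = ![u.1, u.2.1, u.2.2] i := by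
  have hex : ∀ i : Fin 3, ∃ e, v ∈ G.ends e ∧ (g e : ℕ) = ![u.1, u.2.1, u.2.2] i := by
    intro i
    have : ![u.1, u.2.1, u.2.2] i ∈ edgeSet u := by
      fin_cases i <;> simp [edgeSet]
    rw [← hu] at this
    simpa [incident] using this
  choose ε hε hg using hex
  have hinj : Function.Injective ![u.1, u.2.1, u.2.2] := by
    intro i k
    fin_cases i <;> fin_cases k <;> simp [hd.1, hd.2.1, hd.2.2, hd.1.symm, hd.2.1.symm, hd.2.2.symm]
  have hτ : Function.Injective fun i => σ (ε i) v := by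
    intro i k h
    have := hσ (hε i) (hε k) h
    exact hinj (by rw [← hg, ← hg, this])
  refine ⟨Equiv.ofBijective _ (Finite.injective_iff_bijective.1 hτ), fun n i => ?_⟩
  simp only [Equiv.ofBijective_apply]
  constructor
  · rintro ⟨e, ⟨he, h⟩, rfl⟩
    rw [hσ he (hε i) h, hg]
  · rintro rfl
    exact ⟨ε i, ⟨hε i, rfl⟩, hg i⟩

theorem Represents.expand {ne : ℕ} {vs : List Triple} (h : Represents G ne vs)
    (hd : ∀ u ∈ vs, u.1 ≠ u.2.1 ∧ u.1 ≠ u.2.2 ∧ u.2.1 ≠ u.2.2) {H : Multigraph}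
    (hH : IsTriangleExpansion G {v} H) :
    ∃ u ∈ vs, ∀ rest, vs.Perm (u :: rest) → Represents H (ne + 3) (truncate ne u rest) := by
  obtain ⟨hl, g, h⟩ := h
  obtain ⟨σ, -, hσ, hi⟩ := hH
  have hmem : (incident G v).image (fun e => (g e : ℕ)) ∈ (↑(vs.map edgeSet) : Multiset _) :=
    h ▸ Multiset.mem_map_of_mem _ (Finset.mem_univ v)
  simp only [Multiset.mem_coe, List.mem_map] at hmem
  obtain ⟨u, huv, hu⟩ := hmem
  refine ⟨u, huv, fun rest p => ?_⟩
  obtain ⟨τ, hτ⟩ := exists_equiv_of_injOn (hd u huv) hu.symm (hσ v rfl)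
  refine Represents.iso (G := expandTriangles G {v} σ)
    ⟨not_isDiag_expandTriangles hl, expandNumbering g τ, ?_⟩ hi
  rw [Multiset.coe_eq_coe.2 (p.map edgeSet), List.map_cons, ← Multiset.cons_coe, hu,
    ← Finset.insert_erase (Finset.mem_univ v),
    Finset.insert_val_of_notMem (Finset.notMem_erase _ _), Multiset.map_cons,
    Multiset.cons_inj_right] at h
  rw [univ_expandTriangles _ τ fun x => (incident G x).image fun e => (g e : ℕ)]
  · rw [h, truncate]
    have key : ∀ i : Fin 3,
        ((incident (expandTriangles G {v} σ) (Sum.inr (⟨v, Set.mem_singleton v⟩, τ i))).image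
          fun e => (expandNumbering g τ e : ℕ)) =
        insert (![u.1, u.2.1, u.2.2] i)
          ((Finset.univ.erase i).image fun k : Fin 3 => ne + (k : ℕ)) := by
      intro i
      ext n
      rw [Finset.mem_insert, ← hτ]
      simp only [Finset.mem_image, incident, Finset.mem_filter, Finset.mem_univ, true_and,
        Finset.mem_erase, and_true]
      refine Sum.exists.trans (or_congr ?_ ⟨?_, ?_⟩)
      · exact exists_congr fun e => and_congr inr_mem_ends_inl Iff.rfl
      · rintro ⟨⟨w, k⟩, hk, rfl⟩
        refine ⟨τ.symm k, fun hki => (inr_mem_ends_inr.1 hk).2 ?_, rfl⟩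
        rw [← hki, Equiv.apply_symm_apply]
      · rintro ⟨k, hk, rfl⟩
        exact ⟨(⟨v, Set.mem_singleton v⟩, τ k),
          inr_mem_ends_inr.2 ⟨rfl, fun h => hk (τ.injective h).symm⟩,
          by rw [expandNumbering_inr, Equiv.symm_apply_apply]⟩
    simp only [key]
    have h3 : (Finset.univ : Finset (Fin 3)).val = ((0 ::ₘ 1 ::ₘ 2 ::ₘ 0 : Multiset (Fin 3))) := rfl
    have e0 : (Finset.univ.erase 0 : Finset (Fin 3)) = {1, 2} := by decide
    have e1 : (Finset.univ.erase 1 : Finset (Fin 3)) = {0, 2} := by decide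
    have e2 : (Finset.univ.erase 2 : Finset (Fin 3)) = {0, 1} := by decide
    rw [h3]
    simp [e0, e1, e2, edgeSet, Finset.image_insert, ← Multiset.cons_coe]
  · intro x
    ext n
    simp only [Finset.mem_image, incident, Finset.mem_filter, Finset.mem_univ, true_and]
    refine Sum.exists.trans (.trans (or_congr_left
      (exists_congr fun e => and_congr inl_mem_ends_inl Iff.rfl)) ?_)
    exact or_iff_left fun ⟨k, hk, _⟩ => inl_not_mem_ends_inr hk

end Expansion

def k4Triples : List Triple := [(0, 1, 2), (0, 3, 4), (1, 3, 5), (2, 4, 5)]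

/-- The triangular prism, obtained from `K4` by replacing one vertex by a triangle. -/
def prismTriples : List Triple := truncate 6 (0, 1, 2) [(0, 3, 4), (1, 3, 5), (2, 4, 5)]

/-- The klee-graph with eight vertices. -/
def octetTriples : List Triple :=
  truncate 9 (0, 7, 8) [(1, 6, 8), (2, 6, 7), (0, 3, 4), (1, 3, 5), (2, 4, 5)]

/-- The edge sets with odd degree at every vertex of the klee-graph with eight vertices. -/
def octetSets : List ℕ :=
  [609, 3169, 417, 4001, 1170, 2706, 2386, 1874, 2316, 1804, 1228, 2764, 519, 3079, 455, 4039, 601,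
    3161, 409, 3993, 1194, 2730, 2410, 1898, 2356, 1844, 1268, 2804, 575, 3135, 511, 4095]

set_option maxRecDepth 100000 in
lemma valid_octet : Valid 12 octetTriples octetSets where
  bound := by decide +kernel
  distinct := by decide +kernel
  nodup := by decide +kernel
  lt := by decide +kernel
  odd := by decide +kernel

set_option maxRecDepth 100000 in
set_option maxHeartbeats 4000000 in
lemma good_octet : good 2 12 octetTriples octetSets = true := by decide +kernel

lemma represents_k4 : Represents Multigraph.K4 6 k4Triples := by
  let q : {p : Fin 4 × Fin 4 // p.1 < p.2} → Fin 6 := fun p =>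
    ![![0, 0, 1, 2], ![0, 0, 3, 4], ![0, 0, 0, 5], ![0, 0, 0, 0]] p.1.1 p.1.2
  have hq : Function.Bijective q := by decide +kernel
  refine ⟨fun e he => e.2.ne (Sym2.mk_isDiag_iff.1 he), Equiv.ofBijective q hq, ?_⟩
  have key : ∀ v : Fin 4, ((Finset.univ.filter fun e : {p : Fin 4 × Fin 4 // p.1 < p.2} =>
      v = e.1.1 ∨ v = e.1.2).image fun e => (q e : ℕ)) =
      edgeSet (![(0, 1, 2), (0, 3, 4), (1, 3, 5), (2, 4, 5)] v) := by decide +kernel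
  have h : ∀ v : Fin 4, ((incident Multigraph.K4 v).image
      fun e => (Equiv.ofBijective q hq e : ℕ)) =
      edgeSet (![(0, 1, 2), (0, 3, 4), (1, 3, 5), (2, 4, 5)] v) := by
    intro v
    rw [← key]
    ext n
    refine Finset.mem_image.trans (.trans (exists_congr fun e => and_congr_left' ?_)
      Finset.mem_image.symm)
    exact mem_incident.trans ((Sym2.mem_iff (α := Fin 4)).trans (by simp))
  exact Multiset.map_congr (s := Finset.univ.val) rfl fun v _ => h v

section

variable {G H : Multigraph} {v : G.V}

lemma Represents.prism (h : Represents G 6 k4Triples)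
    (hH : Multigraph.IsTriangleExpansion G {v} H) : Represents H 9 prismTriples := by
  obtain ⟨u, hu, hr⟩ := h.expand (by decide) hH
  have hr := hr _ (List.perm_cons_erase hu)
  simp only [k4Triples, List.mem_cons, List.not_mem_nil, or_false] at hu
  rcases hu with rfl | rfl | rfl | rfl
  · exact hr
  · exact hr.rename [0, 3, 4, 1, 2, 5, 6, 7, 8] (by decide +kernel) (by decide +kernel)
      (by decide +kernel)
  · exact hr.rename [3, 0, 4, 1, 5, 2, 6, 7, 8] (by decide +kernel) (by decide +kernel)
      (by decide +kernel)
  · exact hr.rename [3, 4, 0, 5, 1, 2, 6, 7, 8] (by decide +kernel) (by decide +kernel)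
      (by decide +kernel)

lemma Represents.octet (h : Represents G 9 prismTriples)
    (hH : Multigraph.IsTriangleExpansion G {v} H) : Represents H 12 octetTriples := by
  obtain ⟨u, hu, hr⟩ := h.expand (by decide) hH
  have hr := hr _ (List.perm_cons_erase hu)
  simp only [prismTriples, truncate, Nat.reduceAdd, List.mem_cons, List.not_mem_nil,
    or_false] at hu
  rcases hu with rfl | rfl | rfl | rfl | rfl | rfl
  · exact hr
  · exact hr.rename [1, 0, 2, 3, 5, 4, 7, 6, 8, 9, 10, 11] (by decide +kernel) (by decide +kernel)
      (by decide +kernel)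
  · exact hr.rename [1, 2, 0, 5, 3, 4, 7, 8, 6, 9, 10, 11] (by decide +kernel) (by decide +kernel)
      (by decide +kernel)
  · exact hr.rename [0, 2, 1, 7, 8, 6, 5, 3, 4, 9, 10, 11] (by decide +kernel) (by decide +kernel)
      (by decide +kernel)
  · exact hr.rename [2, 0, 1, 7, 6, 8, 3, 5, 4, 9, 10, 11] (by decide +kernel) (by decide +kernel)
      (by decide +kernel)
  · exact hr.rename [2, 1, 0, 6, 7, 8, 3, 4, 5, 9, 10, 11] (by decide +kernel) (by decide +kernel)
      (by decide +kernel)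

end

theorem represents_of_isKlee {G : Multigraph} (h : Multigraph.IsKlee G) :
    Represents G 6 k4Triples ∨ Represents G 9 prismTriples ∨
      ∃ d ne vs js, Represents G ne vs ∧ Valid ne vs js ∧ good d ne vs js = true := by
  induction h with
  | k4 G h => exact .inl (represents_k4.iso h)
  | expand G v H _ hH ih =>
    rcases ih with h | h | ⟨d, ne, vs, js, h, hv, hg⟩
    · exact .inr (.inl (h.prism hH))
    · exact .inr (.inr ⟨2, 12, _, _, h.octet hH, valid_octet, good_octet⟩)
    · obtain ⟨u, hu, hr⟩ := h.expand hv.distinct hH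
      obtain ⟨rest, d', p, hv', hg'⟩ := good_truncate hv hg hu
      exact .inr (.inr ⟨d', _, _, _, hr rest p, hv', hg'⟩)

theorem three_mul_card_le {G : Multigraph} (h : Multigraph.IsKlee G) :
    3 * Fintype.card G.V ≤ 4 * G.pmCount + 24 := by
  rcases represents_of_isKlee h with h | h | ⟨d, ne, vs, js, h, hv, hg⟩
  · have : Fintype.card G.V = 4 := h.card_eq
    omega
  · have : Fintype.card G.V = 6 := h.card_eq
    omega
  · have := h.card_eq
    have := h.pms_le hv
    have := bound_of_good hg
    omega

end KleeModel

open Multigraph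
/-- Every klee-graph with `n` vertices has at least `3n/4 - 6`
perfect matchings. -/
theorem klee_many_perfect_matchings (G : Multigraph) (hklee : IsKlee G) :
    3 * (Fintype.card G.V : ℝ) / 4 - 6 ≤ (G.pmCount : ℝ) := by
  have h : (3 * Fintype.card G.V : ℝ) ≤ 4 * G.pmCount + 24 := by
    exact_mod_cast KleeModel.three_mul_card_le hklee
  linarith
end
end

section
/- Every cubic bipartite graph with n vertices has at least 3n/2 − 9 perfect matchings. -/
open scoped Classical

noncomputable section

open Multigraph

namespace Matrix

section Linear

variable {n R : Type*} [DecidableEq n] [Fintype n] [CommSemiring R]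

theorem permanent_updateCol_add (M : Matrix n n R) (j : n) (u v : n → R) :
    permanent (M.updateCol j (u + v)) =
      permanent (M.updateCol j u) + permanent (M.updateCol j v) := by
  simp only [permanent, ← Finset.mul_prod_erase _ _ (Finset.mem_univ j), updateCol_self,
    Pi.add_apply, add_mul, Finset.sum_add_distrib]
  congr 1 <;>
  · refine Finset.sum_congr rfl fun σ _ => ?_
    congr 1
    refine Finset.prod_congr rfl fun i hi => ?_
    simp only [ne_eq, Finset.ne_of_mem_erase hi, not_false_eq_true, updateCol_ne]

theorem permanent_updateRow_add (M : Matrix n n R) (i : n) (u v : n → R) :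
    permanent (M.updateRow i (u + v)) =
      permanent (M.updateRow i u) + permanent (M.updateRow i v) := by
  simp only [← permanent_transpose (updateRow _ _ _), ← updateCol_transpose,
    permanent_updateCol_add]

/-- The permanent as a linear function of one row. -/
def permanentRowLinear (M : Matrix n n R) (i : n) : (n → R) →ₗ[R] R where
  toFun v := permanent (M.updateRow i v)
  map_add' := permanent_updateRow_add M i
  map_smul' c v := permanent_updateRow_smul M i c v

end Linear

theorem permanent_succ_column_zero {R : Type*} [CommSemiring R] {n : ℕ}
    (A : Matrix (Fin (n + 1)) (Fin (n + 1)) R) :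
    A.permanent = A 0 0 * (A.submatrix Fin.succ Fin.succ).permanent +
      ∑ w, A w.succ 0 *
        ((A.submatrix Fin.succ Fin.succ).updateRow w fun c => A 0 c.succ).permanent := by
  have expand : A.permanent = ∑ p, A p 0 *
      (A.submatrix (fun x : Fin n => Equiv.swap 0 p x.succ) Fin.succ).permanent := by
    rw [permanent, ← Equiv.Perm.decomposeFin.symm.sum_comp, Fintype.sum_prod_type]
    simp only [Fin.prod_univ_succ, Equiv.Perm.decomposeFin_symm_apply_zero,
      Equiv.Perm.decomposeFin_symm_apply_succ, permanent, Finset.mul_sum, submatrix_apply]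
  rw [expand, Fin.sum_univ_succ]
  congr 1
  refine Finset.sum_congr rfl fun w _ => ?_
  congr 2
  ext r c
  by_cases h : r = w
  · simp [h]
  · rw [updateRow_ne h, submatrix_apply, submatrix_apply,
      Equiv.swap_apply_of_ne_of_ne (Fin.succ_ne_zero r) (by simpa using h)]

variable {n : ℕ}

/-- If row `i` has sum `s + 1`, the permanent is a weighted average of the permanents
obtained by lowering one positive entry of that row. -/
theorem mul_le_mul_permanent {m : Type*} [DecidableEq m] [Fintype m] (A : Matrix m m ℕ)
    (i : m) {s L : ℕ} (hs : ∑ c, A i c = s + 1)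
    (hL : ∀ c, 0 < A i c → L ≤ (A.updateRow i (A i - Pi.single c 1)).permanent) :
    (s + 1) * L ≤ s * A.permanent := by
  have hA : A.permanent = permanentRowLinear A i (A i) := by
    change _ = (A.updateRow i (A i)).permanent
    rw [updateRow_eq_self]
  have expand : A.permanent = ∑ c, A i c * permanentRowLinear A i (Pi.single c 1) := by
    conv_lhs => rw [hA, LinearMap.pi_apply_eq_sum_univ]
    refine Finset.sum_congr rfl fun c _ => ?_
    rw [smul_eq_mul]
    congr 2
    ext x
    simp [Pi.single_apply, eq_comm]
  have term : ∀ c, A i c * L + A i c * permanentRowLinear A i (Pi.single c 1)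
      ≤ A i c * A.permanent := by
    intro c
    rcases Nat.eq_zero_or_pos (A i c) with h | h
    · simp [h]
    · rw [← mul_add]
      refine Nat.mul_le_mul_left _ ?_
      have split : A i = (A i - Pi.single c 1) + Pi.single c 1 := by
        ext x
        by_cases hx : x = c
        · subst hx; simp; omega
        · simp [hx]
      calc _ ≤ permanentRowLinear A i (A i - Pi.single c 1) +
              permanentRowLinear A i (Pi.single c 1) := Nat.add_le_add_right (hL c h) _
        _ = A.permanent := by rw [← map_add, ← split, hA]
  have total := Finset.sum_le_sum fun c (_ : c ∈ Finset.univ) => term c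
  rw [Finset.sum_add_distrib, ← Finset.sum_mul, ← Finset.sum_mul, ← expand, hs] at total
  linarith [total]

/-- All row and column sums of `A` are three. -/
def IsThreeRegular (A : Matrix (Fin n) (Fin n) ℕ) : Prop :=
  (∀ r, ∑ c, A r c = 3) ∧ ∀ c, ∑ r, A r c = 3

/-- All row and column sums of `A` are three, except that row `i` and column `j` have sum two. -/
def IsNearThreeRegular (A : Matrix (Fin n) (Fin n) ℕ) (i j : Fin n) : Prop :=
  (∀ r, ∑ c, A r c + (if r = i then 1 else 0) = 3) ∧
    ∀ c, ∑ r, A r c + (if c = j then 1 else 0) = 3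

theorem sum_updateRow (A : Matrix (Fin n) (Fin n) ℕ) (i : Fin n) (v : Fin n → ℕ) (c : Fin n) :
    ∑ r, A.updateRow i v r c + A i c = ∑ r, A r c + v c := by
  rw [← Finset.add_sum_erase _ (fun r => A.updateRow i v r c) (Finset.mem_univ i),
    ← Finset.add_sum_erase _ (fun r => A r c) (Finset.mem_univ i), updateRow_self,
    Finset.sum_congr rfl fun r hr => by rw [updateRow_ne (Finset.ne_of_mem_erase hr)]]
  ring

theorem sum_sub_single {m : Type*} [DecidableEq m] [Fintype m] {v : m → ℕ} {c : m}
    (h : 0 < v c) : ∑ x, (v - Pi.single c 1 : m → ℕ) x + 1 = ∑ x, v x := by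
  rw [← Finset.add_sum_erase _ (v - Pi.single c 1) (Finset.mem_univ c),
    ← Finset.add_sum_erase _ v (Finset.mem_univ c),
    Finset.sum_congr rfl fun x hx => by
      rw [Pi.sub_apply, Pi.single_eq_of_ne (Finset.ne_of_mem_erase hx), Nat.sub_zero],
    Pi.sub_apply, Pi.single_eq_same, add_right_comm, Nat.sub_add_cancel h]

theorem exists_eq_single_of_sum_eq_one {m : Type*} [DecidableEq m] [Fintype m] {v : m → ℕ}
    (h : ∑ x, v x = 1) : ∃ c, v = Pi.single c 1 := by
  obtain ⟨c, -, hc⟩ := Finset.exists_ne_zero_of_sum_ne_zero (h.trans_ne one_ne_zero)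
  have hsum := sum_sub_single (Nat.pos_of_ne_zero hc)
  rw [h, Nat.add_eq_right, Finset.sum_eq_zero_iff] at hsum
  have hle := Finset.single_le_sum (f := v) (fun x _ => Nat.zero_le _) (Finset.mem_univ c)
  refine ⟨c, funext fun x => ?_⟩
  have hx := hsum x (Finset.mem_univ x)
  by_cases hxc : x = c
  · subst hxc
    simp
    omega
  · simpa [hxc] using hx

theorem IsThreeRegular.mul_le_mul_permanent [NeZero n] {A : Matrix (Fin n) (Fin n) ℕ}
    (hA : A.IsThreeRegular) {L : ℕ}
    (hL : ∀ (B : Matrix (Fin n) (Fin n) ℕ) i j, B.IsNearThreeRegular i j → L ≤ B.permanent) :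
    3 * L ≤ 2 * A.permanent := by
  refine A.mul_le_mul_permanent 0 (s := 2) (hA.1 0) fun c hc => hL _ 0 c ⟨fun r => ?_, fun d => ?_⟩
  · by_cases hr : r = 0
    · subst hr
      simpa using (sum_sub_single hc).trans (hA.1 0)
    · simpa [updateRow_ne hr, hr] using hA.1 r
  · have h := sum_updateRow A 0 (A 0 - Pi.single c 1) d
    rw [hA.2 d] at h
    by_cases hd : d = c
    · subst hd
      simp at h ⊢
      omega
    · simp [hd] at h ⊢
      omega

theorem IsNearThreeRegular.reindex {A : Matrix (Fin n) (Fin n) ℕ} {i j : Fin n}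
    (hA : A.IsNearThreeRegular i j) (σ τ : Equiv.Perm (Fin n)) :
    (A.submatrix σ τ).IsNearThreeRegular (σ.symm i) (τ.symm j) := by
  refine ⟨fun r => ?_, fun c => ?_⟩
  · simpa [Equiv.eq_symm_apply, Equiv.sum_comp τ fun c => A (σ r) c] using hA.1 (σ r)
  · simpa [Equiv.eq_symm_apply, Equiv.sum_comp σ fun r => A r (τ c)] using hA.2 (τ c)

theorem IsNearThreeRegular.mul_le_mul_permanent_of_pos [NeZero n]
    {A : Matrix (Fin (n + 1)) (Fin (n + 1)) ℕ} {i : Fin (n + 1)}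
    (hA : A.IsNearThreeRegular i 0) (hpos : 0 < A 0 0) {L : ℕ}
    (hL : ∀ (B : Matrix (Fin n) (Fin n) ℕ) i j, B.IsNearThreeRegular i j → L ≤ B.permanent) :
    4 * L ≤ 3 * A.permanent := by
  set S := A.submatrix Fin.succ Fin.succ with hS
  set v : Fin n → ℕ := fun c => A 0 c.succ with hv
  have hper : A.permanent = A 0 0 * S.permanent +
      ∑ w, A w.succ 0 * (S.updateRow w v).permanent := A.permanent_succ_column_zero
  have hrow : ∀ r, ∑ c, S r c + A r.succ 0 + (if r.succ = i then 1 else 0) = 3 := by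
    intro r
    rw [← hA.1 r.succ, Fin.sum_univ_succ]
    simp only [hS, submatrix_apply]
    ring
  have hrow_zero : ∑ c, v c + A 0 0 + (if 0 = i then 1 else 0) = 3 := by
    rw [← hA.1 0, Fin.sum_univ_succ]
    ring
  have hcol : ∀ c, ∑ r, S r c + v c = 3 := by
    intro c
    have h := hA.2 c.succ
    rw [Fin.sum_univ_succ, if_neg (Fin.succ_ne_zero c)] at h
    simp only [hS, hv, submatrix_apply]
    omega
  have hcol_zero : A 0 0 + ∑ w : Fin n, A w.succ 0 = 2 := by
    have h := hA.2 0
    rw [Fin.sum_univ_succ, if_pos rfl] at h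
    omega
  rcases (by omega : A 0 0 = 2 ∨ A 0 0 = 1) with h00 | h00
  · have hz : ∀ w : Fin n, A w.succ 0 = 0 := by
      simpa [h00] using hcol_zero
    have hper2 : A.permanent = 2 * S.permanent := by simp [hper, hz, h00]
    cases i using Fin.cases with
    | zero =>
      have hv0 : ∀ c, v c = 0 := by simpa [h00] using hrow_zero
      have hreg : S.IsThreeRegular := by
        refine ⟨fun r => ?_, fun c => ?_⟩
        · simpa [hz] using hrow r
        · simpa [hv0] using hcol c
      have := hreg.mul_le_mul_permanent hL
      omega
    | succ i =>
      obtain ⟨d, hd⟩ : ∃ d, v = Pi.single d 1 := by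
        refine exists_eq_single_of_sum_eq_one ?_
        rw [h00, if_neg (Fin.succ_ne_zero i).symm] at hrow_zero
        omega
      have hnear : S.IsNearThreeRegular i d := by
        refine ⟨fun r => ?_, fun c => ?_⟩
        · simpa [hz] using hrow r
        · simpa [hd, Pi.single_apply] using hcol c
      have := hL S i d hnear
      omega
  · obtain ⟨w, hw⟩ : ∃ w, (fun w : Fin n => A w.succ 0) = Pi.single w 1 :=
      exists_eq_single_of_sum_eq_one (by omega)
    replace hw : ∀ r : Fin n, A r.succ 0 = if r = w then 1 else 0 := fun r => by
      rw [← Pi.single_apply, ← hw]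
    set T := S.updateRow w (S w + v) with hT
    have hperT : A.permanent = T.permanent := by
      rw [hT, permanent_updateRow_add, updateRow_eq_self, hper]
      simp [hw, h00]
    have hcolT : ∀ c, ∑ r, T r c = 3 := by
      intro c
      have h : ∑ r, T r c + S w c = ∑ r, S r c + (S w c + v c) := sum_updateRow S w (S w + v) c
      have := hcol c
      omega
    have hrowT : ∀ r, r ≠ w → ∑ c, T r c + (if r.succ = i then 1 else 0) = 3 := by
      intro r hr
      simpa [hT, updateRow_ne hr, hw, hr] using hrow r
    have hrowTw : ∑ c, T w c + (if w.succ = i then 1 else 0) + (if 0 = i then 1 else 0) = 4 := by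
      have h := hrow w
      rw [hw, if_pos rfl] at h
      simp only [hT, updateRow_self, Pi.add_apply, Finset.sum_add_distrib]
      omega
    rw [hperT]
    by_cases hi : i = 0 ∨ i = w.succ
    · have hreg : T.IsThreeRegular := by
        refine ⟨fun r => ?_, hcolT⟩
        by_cases hr : r = w
        · subst hr
          rcases hi with rfl | rfl <;> simpa [(Fin.succ_ne_zero r).symm] using hrowTw
        · have hri : r.succ ≠ i := by
            rcases hi with rfl | rfl
            · exact Fin.succ_ne_zero r
            · simpa using hr
          simpa [hri] using hrowT r hr
      have := hreg.mul_le_mul_permanent hL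
      omega
    · push Not at hi
      obtain ⟨i, rfl⟩ := Fin.exists_succ_eq.2 hi.1
      rw [if_neg hi.2.symm, if_neg hi.1.symm] at hrowTw
      refine T.mul_le_mul_permanent w (s := 3) hrowTw fun c hc => hL _ i c ⟨fun r => ?_, fun d => ?_⟩
      · by_cases hr : r = w
        · subst hr
          have h := sum_sub_single hc
          have hri : r ≠ i := fun h => hi.2 (congrArg Fin.succ h.symm)
          simp only [updateRow_self, if_neg hri]
          omega
        · simpa [updateRow_ne hr] using hrowT r hr
      · have h := sum_updateRow T w (T w - Pi.single c 1) d
        rw [hcolT d] at h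
        by_cases hd : d = c
        · subst hd
          simp at h ⊢
          omega
        · simp [hd] at h ⊢
          omega

theorem IsNearThreeRegular.mul_le_mul_permanent [NeZero n]
    {A : Matrix (Fin (n + 1)) (Fin (n + 1)) ℕ} {i j : Fin (n + 1)}
    (hA : A.IsNearThreeRegular i j) {L : ℕ}
    (hL : ∀ (B : Matrix (Fin n) (Fin n) ℕ) i j, B.IsNearThreeRegular i j → L ≤ B.permanent) :
    4 * L ≤ 3 * A.permanent := by
  have hsum : ∑ r, A r j = 2 := by simpa using hA.2 j
  obtain ⟨p, -, hp⟩ := Finset.exists_ne_zero_of_sum_ne_zero (hsum.trans_ne two_ne_zero)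
  have hB := hA.reindex (Equiv.swap 0 p) (Equiv.swap 0 j)
  rw [Equiv.symm_swap, Equiv.symm_swap, Equiv.swap_apply_right] at hB
  have key := hB.mul_le_mul_permanent_of_pos (by simpa using Nat.pos_of_ne_zero hp) hL
  rwa [← Function.id_comp (Equiv.swap 0 j : Fin (n + 1) → Fin (n + 1)),
    ← Function.comp_id (Equiv.swap 0 p : Fin (n + 1) → Fin (n + 1)), ← submatrix_submatrix,
    permanent_permute_rows, permanent_permute_cols] at key

theorem IsNearThreeRegular.le_permanent {A : Matrix (Fin n) (Fin n) ℕ} {i j : Fin n}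
    (hA : A.IsNearThreeRegular i j) : max (n + 1) (2 * n - 6) ≤ A.permanent := by
  induction n with
  | zero => exact i.elim0
  | succ n ih =>
    rcases Nat.eq_zero_or_pos n with rfl | hn
    · obtain rfl : i = 0 := by omega
      have h := hA.1 0
      rw [Fin.sum_univ_succ, Fin.sum_univ_zero, if_pos rfl] at h
      rw [permanent_eq_elem_of_card_eq_one (Fintype.card_fin 1) 0]
      omega
    · have : NeZero n := ⟨hn.ne'⟩
      have h := hA.mul_le_mul_permanent fun B i j hB => ih hB
      omega

/-- A linear weakening of Voorhoeve's exponential lower bound. -/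
theorem IsThreeRegular.le_permanent {A : Matrix (Fin n) (Fin n) ℕ} (hA : A.IsThreeRegular) :
    3 * n ≤ A.permanent + 9 := by
  rcases Nat.eq_zero_or_pos n with rfl | hn
  · omega
  · have : NeZero n := ⟨hn.ne'⟩
    have h := hA.mul_le_mul_permanent fun B i j hB => hB.le_permanent
    omega

end Matrix

namespace Multigraph

variable {G : Multigraph}

theorem inc_eq_of_ends {e : G.E} {u w : G.V} (h : G.ends e = s(u, w)) (hne : u ≠ w) (v : G.V) :
    G.inc v e = (if u = v then 1 else 0) + (if w = v then 1 else 0) := by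
  have hdiag : s(u, w) ≠ Sym2.diag v := by
    intro hd
    exact hne (Sym2.mk_isDiag_iff.1 (hd ▸ Sym2.diag_isDiag v))
  rw [inc, h, if_neg hdiag]
  by_cases hu : u = v
  · subst hu
    simp [hne.symm]
  · simp [hu, Ne.symm hu, eq_comm]

theorem permanent_le_pmCount {X : Set G.V} {n : ℕ} (a : Fin n ≃ {v // v ∈ X})
    (b : Fin n ≃ {v // v ∉ X}) (l r : G.E → Fin n)
    (hends : ∀ e, G.ends e = s((a (l e) : G.V), (b (r e) : G.V))) :
    (Matrix.of fun i j => Fintype.card {e // l e = i ∧ r e = j}).permanent ≤ G.pmCount := by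
  have hab : ∀ i j, (a i : G.V) ≠ b j := fun i j h => (b j).2 (h ▸ (a i).2)
  have mem_left : ∀ i e, (a i : G.V) ∈ G.ends e ↔ l e = i := fun i e => by
    simp [hends, hab, Subtype.val_inj, eq_comm]
  have mem_right : ∀ j e, (b j : G.V) ∈ G.ends e ↔ r e = j := fun j e => by
    simp [hends, (hab _ _).symm, Subtype.val_inj, eq_comm]
  let F := Σ σ : Equiv.Perm (Fin n), ∀ i, {e // l e = σ i ∧ r e = i}
  have hcard : (Matrix.of fun i j => Fintype.card {e // l e = i ∧ r e = j}).permanent =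
      Nat.card F := by
    simp only [F, Nat.card_eq_fintype_card, Fintype.card_sigma, Fintype.card_pi,
      Matrix.permanent, Matrix.of_apply]
  let edges : F → Finset G.E := fun f => Finset.univ.image fun i => (f.2 i).1
  have mem_edges : ∀ f e, e ∈ edges f ↔ (f.2 (r e)).1 = e := by
    intro f e
    simp only [edges, Finset.mem_image, Finset.mem_univ, true_and]
    refine ⟨?_, fun h => ⟨_, h⟩⟩
    rintro ⟨i, rfl⟩
    rw [(f.2 i).2.2]
  have isPM : ∀ f, G.IsPerfectMatching (edges f) := by
    intro f
    refine ⟨fun e _ => by simpa [hends] using hab _ _, fun v => ?_⟩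
    by_cases hv : v ∈ X
    · obtain ⟨i, hi⟩ := a.surjective ⟨v, hv⟩
      obtain rfl : (a i : G.V) = v := congrArg Subtype.val hi
      refine ⟨(f.2 (f.1.symm i)).1, ⟨?_, ?_⟩, ?_⟩
      · rw [mem_edges, (f.2 _).2.2]
      · rw [mem_left, (f.2 _).2.1, Equiv.apply_symm_apply]
      · rintro e ⟨he, hve⟩
        rw [mem_left] at hve
        rw [mem_edges] at he
        have h := (f.2 (r e)).2.1
        rw [he, hve] at h
        rw [h, Equiv.symm_apply_apply, he]
    · obtain ⟨j, hj⟩ := b.surjective ⟨v, hv⟩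
      obtain rfl : (b j : G.V) = v := congrArg Subtype.val hj
      refine ⟨(f.2 j).1, ⟨?_, ?_⟩, ?_⟩
      · rw [mem_edges, (f.2 _).2.2]
      · rw [mem_right, (f.2 _).2.2]
      · rintro e ⟨he, hve⟩
        rw [mem_right] at hve
        rw [← hve, (mem_edges f e).1 he]
  rw [hcard, pmCount]
  refine Nat.card_le_card_of_injective (fun f => ⟨edges f, isPM f⟩) ?_
  intro f g hfg
  have hedges : edges f = edges g := congrArg Subtype.val hfg
  have hval : ∀ i, (f.2 i).1 = (g.2 i).1 := by
    intro i
    have h : (f.2 i).1 ∈ edges g := hedges ▸ (mem_edges f _).2 (by rw [(f.2 i).2.2])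
    rw [mem_edges, (f.2 i).2.2] at h
    exact h.symm
  obtain ⟨σ, f⟩ := f
  obtain ⟨τ, g⟩ := g
  obtain rfl : σ = τ := by
    ext i
    rw [← (f i).2.1, ← (g i).2.1, hval i]
  congr
  funext i
  exact Subtype.ext (hval i)

theorem card_fiber_left {X : Set G.V} {u w : G.E → G.V} (hcubic : G.IsCubic)
    (hends : ∀ e, G.ends e = s(u e, w e)) (hu : ∀ e, u e ∈ X) (hw : ∀ e, w e ∉ X)
    {v : G.V} (hv : v ∈ X) : ∑ e, (if u e = v then 1 else 0) = 3 := by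
  rw [← hcubic v, degree]
  refine Finset.sum_congr rfl fun e _ => ?_
  have hne : u e ≠ w e := fun h => hw e (h ▸ hu e)
  have hwv : w e ≠ v := fun h => hw e (h ▸ hv)
  rw [inc_eq_of_ends (hends e) hne, if_neg hwv, add_zero]

theorem three_mul_card {X : Set G.V} {u : G.E → G.V} (hu : ∀ e, u e ∈ X)
    (hfiber : ∀ v ∈ X, ∑ e, (if u e = v then 1 else 0) = 3) :
    3 * Fintype.card {v // v ∈ X} = Fintype.card G.E := by
  calc 3 * Fintype.card {v // v ∈ X}
      = ∑ v : {v // v ∈ X}, ∑ e, (if u e = v.1 then 1 else 0) := by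
        simp [fun v : {v // v ∈ X} => hfiber v.1 v.2, mul_comm]
    _ = ∑ e : G.E, ∑ v : {v // v ∈ X}, (if (⟨u e, hu e⟩ : {v // v ∈ X}) = v then 1 else 0) := by
        rw [Finset.sum_comm]
        simp only [Subtype.ext_iff]
    _ = Fintype.card G.E := by simp

end Multigraph

/-- Every cubic bipartite graph with `n` vertices has at least
`3n/2 - 9` perfect matchings. -/
theorem cubic_bipartite_many_perfect_matchings (G : Multigraph)
    (hcubic : G.IsCubic) (hbip : G.Bipartite) :
    3 * (Fintype.card G.V : ℝ) / 2 - 9 ≤ (G.pmCount : ℝ) := by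
  obtain ⟨X, hX⟩ := hbip
  choose u w hends hu hw using hX
  have hleft : ∀ v ∈ X, ∑ e, (if u e = v then 1 else 0) = 3 :=
    fun v hv => card_fiber_left hcubic hends hu hw hv
  have hright : ∀ v ∈ Xᶜ, ∑ e, (if w e = v then 1 else 0) = 3 :=
    fun v hv => card_fiber_left (X := Xᶜ) hcubic (fun e => (hends e).trans Sym2.eq_swap) hw
      (fun e h => h (hu e)) hv
  have hcardL := three_mul_card hu hleft
  have hcardR : 3 * Fintype.card {v // v ∉ X} = Fintype.card G.E := by
    convert three_mul_card hw hright
  set n := Fintype.card {v // v ∈ X}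
  have hV : Fintype.card G.V = n + Fintype.card {v // v ∉ X} := by
    rw [← Fintype.card_sum]
    exact Fintype.card_congr (Equiv.sumCompl (· ∈ X)).symm
  let a : Fin n ≃ {v // v ∈ X} := (Fintype.equivFin _).symm
  let b : Fin n ≃ {v // v ∉ X} := (Fintype.equivFinOfCardEq (by omega)).symm
  let l : G.E → Fin n := fun e => a.symm ⟨u e, hu e⟩
  let r : G.E → Fin n := fun e => b.symm ⟨w e, hw e⟩
  have hperm := permanent_le_pmCount a b l r fun e => by simp [l, r, hends]
  have hreg : (Matrix.of fun i j => Fintype.card {e // l e = i ∧ r e = j}).IsThreeRegular := by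
    simp only [Matrix.IsThreeRegular, Matrix.of_apply, Fintype.card_subtype, Finset.card_filter]
    refine ⟨fun i => ?_, fun j => ?_⟩
    · rw [Finset.sum_comm, ← hleft (a i) (a i).2]
      refine Finset.sum_congr rfl fun e _ => ?_
      simp [l, ite_and, Equiv.symm_apply_eq, Subtype.ext_iff]
    · rw [Finset.sum_comm, ← hright (b j) (b j).2]
      refine Finset.sum_congr rfl fun e _ => ?_
      simp [r, ite_and, Equiv.symm_apply_eq, Subtype.ext_iff]
  have hbound := hreg.le_permanent
  have hnat : 3 * n ≤ G.pmCount + 9 := by omega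
  have hV2 : Fintype.card G.V = 2 * n := by omega
  have hreal : (3 * n : ℝ) ≤ G.pmCount + 9 := by exact_mod_cast hnat
  rw [hV2]
  push_cast
  linarith
end
end
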